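/- arXiv:1805.11064 — 4 statements merged into one kernel-verified Lean document; each statement's English description precedes it below -/
import Mathlib

section
/- Let ϖ_{r,λ} be the distribution on [√(1−λ²), 1] of the random variable ⟨v, (1+λrU)·v⟩ (which is independent of v ∈ 𝕊^L). Then ϖ_{r,λ} = P(r = 0)·δ_1 + ϖ^{ac}, where δ_1 is the Dirac measure at 1 and ϖ^{ac} is a measure absolutely continuous with respect to Lebesgue measure; in particular the pure point part of ϖ_{r,λ} equals P(r = 0)·δ_1 and the singular continuous part vanishes. -/
open MeasureTheory ProbabilityTheory Matrix Real
open scoped ENNReal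

noncomputable section

abbrev Sph (L : ℕ) := Metric.sphere (0 : EuclideanSpace ℝ (Fin (L+1))) 1

/-- The projective action `T · v = T v / ‖T v‖` on vectors. -/
noncomputable def act {n : ℕ} (T : Matrix (Fin n) (Fin n) ℝ)
    (v : EuclideanSpace ℝ (Fin n)) : EuclideanSpace ℝ (Fin n) :=
  ‖Matrix.toEuclideanLin T v‖⁻¹ • Matrix.toEuclideanLin T v

/-- The projective action on the unit sphere (junk value `v` if `T v = 0`). -/
noncomputable def actS {L : ℕ} (T : Matrix (Fin (L+1)) (Fin (L+1)) ℝ) (v : Sph L) : Sph L :=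
  if h : ‖Matrix.toEuclideanLin T (v : EuclideanSpace ℝ (Fin (L+1)))‖ = 0 then v
  else ⟨act T v, by
    rw [mem_sphere_zero_iff_norm, act, norm_smul, norm_inv, norm_norm, inv_mul_cancel₀ h]⟩

instance {m n α : Type*} [MeasurableSpace α] : MeasurableSpace (Matrix m n α) :=
  inferInstanceAs (MeasurableSpace (m → n → α))

/-- `U` is Haar distributed on the orthogonal group `O(L+1)`: it takes values in the
orthogonal group and its law is invariant under left translation (which characterizes
the Haar probability measure on this compact group). -/
def IsHaarOrth {L : ℕ} {Ω : Type*} [MeasurableSpace Ω] (P : Measure Ω)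
    (U : Ω → Matrix (Fin (L+1)) (Fin (L+1)) ℝ) : Prop :=
  Measurable U ∧ (∀ ω, U ω ∈ Matrix.orthogonalGroup (Fin (L+1)) ℝ) ∧
    ∀ O ∈ Matrix.orthogonalGroup (Fin (L+1)) ℝ,
      Measure.map (fun ω => O * U ω) P = Measure.map U P

/-- `ν` is the normalized rotation-invariant surface measure on the sphere: it is the unique
rotation-invariant Borel probability measure. -/
def IsUniformSphere {L : ℕ} (ν : Measure (Sph L)) : Prop :=
  IsProbabilityMeasure ν ∧
    ∀ O ∈ Matrix.orthogonalGroup (Fin (L+1)) ℝ, Measure.map (actS O) ν = ν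

/-- Topological support of a measure. -/
def msupport {X : Type*} [TopologicalSpace X] [MeasurableSpace X] (μ : Measure X) : Set X :=
  {x | ∀ s : Set X, IsOpen s → x ∈ s → 0 < μ s}

/-- `‖𝔞(v)‖²`, the squared norm of the first `La` components. -/
noncomputable def naSq {n : ℕ} (La : ℕ) (v : EuclideanSpace ℝ (Fin n)) : ℝ :=
  ∑ k : Fin n, if (k : ℕ) < La then (v k)^2 else 0

/-- `‖𝔠(v)‖²`, the squared norm of the components with index `> La + Lb`. -/
noncomputable def ncSq {n : ℕ} (Lab : ℕ) (v : EuclideanSpace ℝ (Fin n)) : ℝ :=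
  ∑ k : Fin n, if Lab ≤ (k : ℕ) then (v k)^2 else 0

/-- Ordered application of the (random) matrices `M 0, …, M (N-1)` to `v`. -/
noncomputable def chainW {L : ℕ} {Ω : Type*}
    (M : ℕ → Ω → Matrix (Fin (L+1)) (Fin (L+1)) ℝ) :
    ℕ → Ω → Sph L → Sph L
  | 0, _, v => v
  | (n+1), ω, v => actS (M n ω) (chainW M n ω v)

/-- Ordered application of the matrices `M 0, …, M (N-1)` to `v` (deterministic). -/
noncomputable def chainD {L : ℕ} (M : ℕ → Matrix (Fin (L+1)) (Fin (L+1)) ℝ) :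
    ℕ → Sph L → Sph L
  | 0, v => v
  | (n+1), v => actS (M n) (chainD M n v)

/-- Preimages of Lebesgue null sets under an injective function with nonvanishing derivative are
null. -/
theorem volume_inter_preimage_eq_zero {s N : Set ℝ} {f f' : ℝ → ℝ} (hs : MeasurableSet s)
    (hf : Measurable f) (hN : MeasurableSet N) (hN0 : volume N = 0)
    (hf' : ∀ x ∈ s, HasDerivAt f (f' x) x) (hf'0 : ∀ x ∈ s, f' x ≠ 0) (hinj : Set.InjOn f s) :
    volume (s ∩ f ⁻¹' N) = 0 := by
  have hm : MeasurableSet (s ∩ f ⁻¹' N) := hs.inter (hf hN)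
  have key := lintegral_image_eq_lintegral_abs_deriv_mul hm
    (fun x hx => (hf' x hx.1).hasDerivWithinAt) (hinj.mono Set.inter_subset_left) (fun _ => 1)
  have h0 : volume (f '' (s ∩ f ⁻¹' N)) = 0 :=
    measure_mono_null (by rintro _ ⟨x, hx, rfl⟩; exact hx.2) hN0
  simp only [mul_one, lintegral_one, Measure.restrict_apply MeasurableSet.univ, Set.univ_inter,
    h0] at key
  have hd : ∀ x ∈ s ∩ f ⁻¹' N, f' x = deriv f x := fun x hx => (hf' x hx.1).deriv.symm
  rw [setLIntegral_congr_fun (g := fun x => ENNReal.ofReal |deriv f x|) hm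
    (fun x hx => by simp [hd x hx])] at key
  rw [eq_comm, lintegral_eq_zero_iff (by fun_prop)] at key
  rw [Filter.EventuallyEq, ae_restrict_iff' hm, ae_iff] at key
  refine measure_mono_null (fun x hx => ?_) key
  have := hf'0 x hx.1
  rw [hd x hx] at this
  simpa [this, hx.1] using hx

/-- `⟪v, (1 + a O) · v⟫` as a function of `⟪v, O v⟫`, for a unit vector `v` and orthogonal `O`. -/
def overlap (a x : ℝ) : ℝ := (1 + a * x) / √(1 + 2 * a * x + a ^ 2)

theorem measurable_overlap : Measurable (fun p : ℝ × ℝ => overlap p.1 p.2) := by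
  unfold overlap; fun_prop

theorem hasDerivAt_div_sqrt {p q : ℝ → ℝ} {p' q' x : ℝ} (hp : HasDerivAt p p' x)
    (hq : HasDerivAt q q' x) (h : 0 < q x) :
    HasDerivAt (fun y => p y / √(q y)) ((p' * q x - p x * q' / 2) / (q x * √(q x))) x := by
  have hs : √(q x) ≠ 0 := (Real.sqrt_pos.2 h).ne'
  refine (hp.div (hq.sqrt h.ne') hs).congr_deriv ?_
  have h2 : √(q x) ^ 2 = q x := Real.sq_sqrt h.le
  have h0 := h.ne'
  field_simp
  rw [h2]
  ring

theorem hasDerivAt_overlap {a x : ℝ} (h : 0 < 1 + 2 * a * x + a ^ 2) :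
    HasDerivAt (overlap a)
      (a ^ 2 * (x + a) / ((1 + 2 * a * x + a ^ 2) * √(1 + 2 * a * x + a ^ 2))) x := by
  have hp : HasDerivAt (fun y : ℝ => 1 + a * y) a x := by
    simpa using ((hasDerivAt_id x).const_mul a).const_add 1
  have hq : HasDerivAt (fun y : ℝ => 1 + 2 * a * y + a ^ 2) (2 * a) x := by
    simpa using (((hasDerivAt_id x).const_mul (2 * a)).const_add 1).add_const (a ^ 2)
  exact (hasDerivAt_div_sqrt hp hq h).congr_deriv (by ring)

theorem one_add_pos {a x : ℝ} (ha : a ∈ Set.Ioo (0 : ℝ) 1) (hx : x ∈ Set.Icc (-1 : ℝ) 1) :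
    0 < 1 + 2 * a * x + a ^ 2 := by
  nlinarith [mul_nonneg ha.1.le (by linarith [hx.1] : 0 ≤ x + 1), sq_pos_of_pos (sub_pos.2 ha.2)]

theorem overlap_eq_imp {a x y : ℝ} (ha : a ∈ Set.Ioo (0 : ℝ) 1) (hx : x ∈ Set.Icc (-1 : ℝ) 1)
    (hy : y ∈ Set.Icc (-1 : ℝ) 1) (h : overlap a x = overlap a y) (hxy : x ≠ y) :
    2 * (1 + a * x) * (1 + a * y) = (1 - a ^ 2) * ((1 + a * x) + (1 + a * y)) := by
  have px := one_add_pos ha hx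
  have py := one_add_pos ha hy
  have h2 : overlap a x ^ 2 = overlap a y ^ 2 := by rw [h]
  simp only [overlap, div_pow, Real.sq_sqrt px.le, Real.sq_sqrt py.le] at h2
  rw [div_eq_div_iff px.ne' py.ne'] at h2
  have : (a * (x - y)) * (2 * (1 + a * x) * (1 + a * y) -
      (1 - a ^ 2) * ((1 + a * x) + (1 + a * y))) = 0 := by linear_combination h2
  rcases mul_eq_zero.1 this with h | h
  · exact absurd h (mul_ne_zero ha.1.ne' (sub_ne_zero.2 hxy))
  · linarith

theorem volume_preimage_overlap_eq_zero {a : ℝ} (ha : a ∈ Set.Ioo (0 : ℝ) 1) {N : Set ℝ}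
    (hN : MeasurableSet N) (hN0 : volume N = 0) :
    volume (Set.Icc (-1) 1 ∩ overlap a ⁻¹' N) = 0 := by
  have hmeas : Measurable (overlap a) := measurable_overlap.comp measurable_prodMk_left
  have key : ∀ s ⊆ Set.Icc (-1 : ℝ) 1, MeasurableSet s → (∀ x ∈ s, x + a ≠ 0) →
      Set.InjOn (overlap a) s → volume (s ∩ overlap a ⁻¹' N) = 0 := fun s hs hm h0 hinj =>
    volume_inter_preimage_eq_zero hm hmeas hN hN0
      (fun x hx => hasDerivAt_overlap (one_add_pos ha (hs hx)))
      (fun x hx => by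
        have := one_add_pos ha (hs hx)
        have := Real.sqrt_pos.2 this
        have := ha.1
        exact div_ne_zero (mul_ne_zero (by positivity) (h0 x hx)) (by positivity)) hinj
  have h1 := key (Set.Icc (-1) 1 ∩ Set.Iio (-a)) Set.inter_subset_left
    (measurableSet_Icc.inter measurableSet_Iio) (fun x hx => by have := hx.2; simp at this; linarith)
    (fun x hx y hy h => by
      by_contra hxy
      have e := overlap_eq_imp ha hx.1 hy.1 h hxy
      have hxa : x < -a := hx.2
      have hya : y < -a := hy.2
      have := ha.1
      have := ha.2
      have h3 : 0 < 1 + a * x := by nlinarith [hx.1.1]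
      have h4 : 0 < 1 + a * y := by nlinarith [hy.1.1]
      have h5 : 1 + a * x < 1 - a ^ 2 := by nlinarith
      have h6 : 1 + a * y < 1 - a ^ 2 := by nlinarith
      nlinarith [mul_lt_mul_of_pos_left h5 h4, mul_lt_mul_of_pos_left h6 h3])
  have h2 := key (Set.Icc (-1) 1 ∩ Set.Ioi (-a)) Set.inter_subset_left
    (measurableSet_Icc.inter measurableSet_Ioi) (fun x hx => by have := hx.2; simp at this; linarith)
    (fun x hx y hy h => by
      by_contra hxy
      have e := overlap_eq_imp ha hx.1 hy.1 h hxy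
      have hxa : -a < x := hx.2
      have hya : -a < y := hy.2
      have := ha.1
      have := ha.2
      have h3 : 0 < 1 + a * x := by nlinarith [hx.1.1]
      have h4 : 0 < 1 + a * y := by nlinarith [hy.1.1]
      have h5 : 1 - a ^ 2 < 1 + a * x := by nlinarith
      have h6 : 1 - a ^ 2 < 1 + a * y := by nlinarith
      nlinarith [mul_lt_mul_of_pos_left h5 h4, mul_lt_mul_of_pos_left h6 h3])
  have h3 : volume ({-a} : Set ℝ) = 0 := by simp
  refine measure_mono_null (fun x hx => ?_) (measure_union_null (measure_union_null h1 h2) h3)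
  rcases lt_trichotomy x (-a) with h | h | h
  · exact Or.inl (Or.inl ⟨⟨hx.1, h⟩, hx.2⟩)
  · exact Or.inr h
  · exact Or.inl (Or.inr ⟨⟨hx.1, h⟩, hx.2⟩)

theorem volume_preimage_div_sqrt_eq_zero (b : ℝ) {c : ℝ} (hc : 0 < c) {N : Set ℝ}
    (hN : MeasurableSet N) (hN0 : volume N = 0) :
    volume {t : ℝ | (b + t) / √((b + t) ^ 2 + c) ∈ N} = 0 := by
  have hpos : ∀ t : ℝ, 0 < (b + t) ^ 2 + c := fun t => by positivity
  have hder : ∀ t : ℝ, HasDerivAt (fun t => (b + t) / √((b + t) ^ 2 + c))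
      (c / (((b + t) ^ 2 + c) * √((b + t) ^ 2 + c))) t := fun t => by
    have hp : HasDerivAt (fun y : ℝ => b + y) 1 t := (hasDerivAt_id t).const_add b
    have hq : HasDerivAt (fun y : ℝ => (b + y) ^ 2 + c) (2 * (b + t)) t := by
      simpa using (hp.pow 2).add_const c
    exact (hasDerivAt_div_sqrt hp hq (hpos t)).congr_deriv (by ring)
  have hder_pos : ∀ t : ℝ, 0 < c / (((b + t) ^ 2 + c) * √((b + t) ^ 2 + c)) := fun t => by
    have := hpos t
    positivity
  have hmono : StrictMono (fun t => (b + t) / √((b + t) ^ 2 + c)) :=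
    strictMono_of_hasDerivAt_pos hder hder_pos
  have := volume_inter_preimage_eq_zero MeasurableSet.univ (by fun_prop) hN hN0
    (fun x _ => hder x) (fun x _ => (hder_pos x).ne') hmono.injective.injOn
  rwa [Set.univ_inter] at this

open scoped RealInnerProductSpace

/-- For a unit vector `u`, the cosine of the angle to `u` avoids any given null set almost
everywhere. -/
theorem ae_inner_div_norm_notMem {n : ℕ} (hn : 2 ≤ n) {u : EuclideanSpace ℝ (Fin n)}
    (hu : ‖u‖ = 1) {N : Set ℝ} (hN : MeasurableSet N) (hN0 : volume N = 0) :
    ∀ᵐ g : EuclideanSpace ℝ (Fin n), ⟪g, u⟫ / ‖g‖ ∉ N := by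
  have hspan : ∀ᵐ g : EuclideanSpace ℝ (Fin n), g ∉ (ℝ ∙ u) := by
    have h : (ℝ ∙ u) ≠ ⊤ := fun h => by
      have h1 := finrank_span_singleton (K := ℝ) (v := u) (by rintro rfl; simp at hu)
      rw [h, finrank_top, finrank_euclideanSpace, Fintype.card_fin] at h1
      omega
    exact measure_eq_zero_iff_ae_notMem.1 (Measure.addHaar_submodule volume _ h)
  have hmeas : MeasurableSet {g : EuclideanSpace ℝ (Fin n) | ⟪g, u⟫ / ‖g‖ ∈ N → g ∈ (ℝ ∙ u)} := by
    have h1 : MeasurableSet {g : EuclideanSpace ℝ (Fin n) | ⟪g, u⟫ / ‖g‖ ∈ N} :=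
      (by fun_prop : Measurable fun g : EuclideanSpace ℝ (Fin n) => ⟪g, u⟫ / ‖g‖) hN
    have h2 : MeasurableSet {g : EuclideanSpace ℝ (Fin n) | g ∈ (ℝ ∙ u)} :=
      (ℝ ∙ u).closed_of_finiteDimensional.measurableSet
    exact h1.imp h2
  have key := ae_mem_of_ae_add_linearMap_mem (LinearMap.toSpanSingleton ℝ _ u) volume
    (volume : Measure (EuclideanSpace ℝ (Fin n))) hmeas (fun y => by
      by_cases hy : y ∈ (ℝ ∙ u)
      · refine .of_forall fun t _ => add_mem hy ?_
        exact Submodule.smul_mem _ _ (Submodule.mem_span_singleton_self u)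
      · have hc : 0 < ‖y‖ ^ 2 - ⟪y, u⟫ ^ 2 := by
          have h1 : ‖y - ⟪y, u⟫ • u‖ ^ 2 = ‖y‖ ^ 2 - ⟪y, u⟫ ^ 2 := by
            rw [norm_sub_sq_real, inner_smul_right, norm_smul, hu, mul_one, Real.norm_eq_abs,
              sq_abs]
            ring
          rw [← h1]
          refine pow_pos (norm_pos_iff.2 fun h => hy ?_) 2
          rw [sub_eq_zero.1 h]
          exact Submodule.smul_mem _ _ (Submodule.mem_span_singleton_self u)
        have := volume_preimage_div_sqrt_eq_zero ⟪y, u⟫ hc hN hN0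
        filter_upwards [measure_eq_zero_iff_ae_notMem.1 this] with t ht h
        refine absurd ?_ ht
        have e1 : ⟪y + t • u, u⟫ = ⟪y, u⟫ + t := by
          rw [inner_add_left, inner_smul_left, real_inner_self_eq_norm_sq, hu]; simp
        have e2 : ‖y + t • u‖ = √((⟪y, u⟫ + t) ^ 2 + (‖y‖ ^ 2 - ⟪y, u⟫ ^ 2)) := by
          rw [← Real.sqrt_sq (norm_nonneg (y + t • u)), norm_add_sq_real, inner_smul_right,
            norm_smul, hu, mul_one, Real.norm_eq_abs, sq_abs]
          ring_nf
        simpa [e1, e2] using h)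
  filter_upwards [hspan, key] with g h1 h2 h3 using h1 (h2 h3)

theorem toEuclideanLin_symm_mem_orthogonalGroup {n : ℕ}
    (R : EuclideanSpace ℝ (Fin n) ≃ₗᵢ[ℝ] EuclideanSpace ℝ (Fin n)) :
    Matrix.toEuclideanLin.symm R.toLinearEquiv.toLinearMap ∈
      Matrix.orthogonalGroup (Fin n) ℝ := by
  rw [Matrix.toEuclideanLin_eq_toLin_orthonormal]
  exact R.toMatrix_mem_unitaryGroup (EuclideanSpace.basisFun _ ℝ) (EuclideanSpace.basisFun _ ℝ)

theorem norm_toEuclideanLin_of_mem_orthogonalGroup {n : ℕ} {O : Matrix (Fin n) (Fin n) ℝ}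
    (hO : O ∈ Matrix.orthogonalGroup (Fin n) ℝ) (x : EuclideanSpace ℝ (Fin n)) :
    ‖Matrix.toEuclideanLin O x‖ = ‖x‖ := by
  have h : ‖Matrix.toEuclideanLin O x‖ ^ 2 = ‖x‖ ^ 2 := by
    rw [← real_inner_self_eq_norm_sq, ← LinearMap.adjoint_inner_right,
      ← Matrix.toEuclideanLin_conjTranspose_eq_adjoint, ← real_inner_self_eq_norm_sq]
    congr 1
    rw [Matrix.mem_orthogonalGroup_iff'] at hO
    simp [Matrix.toLpLin_apply, Matrix.mulVec_mulVec, Matrix.conjTranspose_eq_transpose_of_trivial,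
      hO]
  exact (pow_left_inj₀ (norm_nonneg _) (norm_nonneg _) two_ne_zero).1 h

theorem measurable_toEuclideanLin {n : ℕ} (v : EuclideanSpace ℝ (Fin n)) :
    Measurable fun A : Matrix (Fin n) (Fin n) ℝ => Matrix.toEuclideanLin A v := by
  simp only [Matrix.toLpLin_apply]
  refine (WithLp.measurable_toLp 2 _).comp (measurable_pi_lambda _ fun i => ?_)
  simp only [Matrix.mulVec, dotProduct]
  exact Finset.measurable_sum _ fun j _ => Measurable.mul_const
    ((measurable_pi_apply j).comp (measurable_pi_apply (X := fun _ => Fin n → ℝ) i)) _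

/-- The law of a matrix coefficient of a Haar distributed orthogonal matrix is absolutely
continuous. -/
theorem IsHaarOrth.map_inner_absolutelyContinuous {L : ℕ} (hL : 1 ≤ L) {Ω : Type*}
    [MeasurableSpace Ω] {P : Measure Ω} [IsProbabilityMeasure P]
    {U : Ω → Matrix (Fin (L+1)) (Fin (L+1)) ℝ} (hU : IsHaarOrth P U) (v : Sph L) :
    Measure.map (fun ω => ⟪(v : EuclideanSpace ℝ (Fin (L+1))), Matrix.toEuclideanLin (U ω) v⟫) P
      ≪ (volume : Measure ℝ) := by
  obtain ⟨hUm, hUo, hUi⟩ := hU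
  have hv : ‖(v : EuclideanSpace ℝ (Fin (L+1)))‖ = 1 := norm_eq_of_mem_sphere v
  have hm := (measurable_toEuclideanLin (v : EuclideanSpace ℝ (Fin (L+1)))).comp hUm
  refine Measure.AbsolutelyContinuous.mk fun N hN hN0 => ?_
  rw [Measure.map_apply (by exact hm.const_inner) hN]
  have hae : ∀ᵐ g : EuclideanSpace ℝ (Fin (L+1)), ∀ᵐ ω ∂P,
      ⟪g, Matrix.toEuclideanLin (U ω) v⟫ / ‖g‖ ∉ N := by
    rw [Measure.ae_ae_comm]
    · refine .of_forall fun ω => ae_inner_div_norm_notMem (by omega) ?_ hN hN0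
      rw [norm_toEuclideanLin_of_mem_orthogonalGroup (hUo ω), hv]
    · have : Measurable fun x : EuclideanSpace ℝ (Fin (L+1)) × Ω =>
          ⟪x.1, Matrix.toEuclideanLin (U x.2) v⟫ / ‖x.1‖ :=
        (measurable_fst.inner (hm.comp measurable_snd)).div measurable_fst.norm
      exact (this hN).compl
  have hne : ∀ᵐ g : EuclideanSpace ℝ (Fin (L+1)), g ≠ 0 :=
    measure_eq_zero_iff_ae_notMem.1 (measure_singleton (0 : EuclideanSpace ℝ (Fin (L+1))))
  obtain ⟨g, hg, hg0⟩ := (hae.and hne).exists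
  have hg1 : ‖‖g‖⁻¹ • g‖ = ‖(v : EuclideanSpace ℝ (Fin (L+1)))‖ := by
    rw [hv, norm_smul, norm_inv, norm_norm, inv_mul_cancel₀ (norm_ne_zero_iff.2 hg0)]
  set R := (ℝ ∙ (‖g‖⁻¹ • g - (v : EuclideanSpace ℝ (Fin (L+1)))))ᗮ.reflection
  have hR : R (‖g‖⁻¹ • g) = v := Submodule.reflection_sub hg1
  have hmv : MeasurableSet {A : Matrix (Fin (L+1)) (Fin (L+1)) ℝ |
      ⟪(v : EuclideanSpace ℝ (Fin (L+1))), Matrix.toEuclideanLin A v⟫ ∈ N} :=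
    (measurable_toEuclideanLin _).const_inner hN
  have hinv : ∀ A : Matrix (Fin (L+1)) (Fin (L+1)) ℝ, ⟪(v : EuclideanSpace ℝ (Fin (L+1))),
      Matrix.toEuclideanLin (Matrix.toEuclideanLin.symm R.toLinearEquiv.toLinearMap * A) v⟫ =
        ⟪g, Matrix.toEuclideanLin A v⟫ / ‖g‖ := fun A => by
    have h1 : Matrix.toEuclideanLin (Matrix.toEuclideanLin.symm R.toLinearEquiv.toLinearMap * A)
        (v : EuclideanSpace ℝ (Fin (L+1))) = R (Matrix.toEuclideanLin A v) := by
      have h2 : ∀ B : Matrix (Fin (L+1)) (Fin (L+1)) ℝ,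
          Matrix.toEuclideanLin (B * A) (v : EuclideanSpace ℝ (Fin (L+1))) =
            Matrix.toEuclideanLin B (Matrix.toEuclideanLin A v) := fun B => by
        simp [Matrix.toLpLin_apply, Matrix.mulVec_mulVec]
      rw [h2, LinearEquiv.apply_symm_apply]
      rfl
    have h3 := R.inner_map_map (‖g‖⁻¹ • g) (Matrix.toEuclideanLin A v)
    rw [hR] at h3
    rw [h1, h3, inner_smul_left, div_eq_inv_mul]
    simp
  have hUi' := congrArg (fun μ => μ {A : Matrix (Fin (L+1)) (Fin (L+1)) ℝ |
      ⟪(v : EuclideanSpace ℝ (Fin (L+1))), Matrix.toEuclideanLin A v⟫ ∈ N})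
    (hUi _ (toEuclideanLin_symm_mem_orthogonalGroup R))
  have hOm : Measurable fun ω => Matrix.toEuclideanLin.symm R.toLinearEquiv.toLinearMap * U ω := by
    refine measurable_pi_lambda _ fun i => measurable_pi_lambda _ fun j => ?_
    simp only [Matrix.mul_apply]
    exact Finset.measurable_sum _ fun k _ => (((measurable_pi_apply j).comp
      (measurable_pi_apply (X := fun _ => Fin (L+1) → ℝ) k)).comp hUm).const_mul _
  simp only [Measure.map_apply hOm hmv, Measure.map_apply hUm hmv] at hUi'
  refine hUi'.symm.trans ?_
  rw [ae_iff] at hg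
  simp only [not_not] at hg
  simpa only [Set.preimage_ofPred_eq, hinv] using hg

theorem inner_actS_eq_overlap {L : ℕ} {O : Matrix (Fin (L+1)) (Fin (L+1)) ℝ}
    (hO : O ∈ Matrix.orthogonalGroup (Fin (L+1)) ℝ) {a : ℝ} (ha : a ∈ Set.Ico (0 : ℝ) 1)
    (v : Sph L) :
    ⟪(v : EuclideanSpace ℝ (Fin (L+1))), (actS (1 + a • O) v : EuclideanSpace ℝ (Fin (L+1)))⟫ =
      overlap a ⟪(v : EuclideanSpace ℝ (Fin (L+1))), Matrix.toEuclideanLin O v⟫ := by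
  have hv : ‖(v : EuclideanSpace ℝ (Fin (L+1)))‖ = 1 := norm_eq_of_mem_sphere v
  have hT : Matrix.toEuclideanLin (1 + a • O) (v : EuclideanSpace ℝ (Fin (L+1))) =
      (v : EuclideanSpace ℝ (Fin (L+1))) + a • Matrix.toEuclideanLin O (v : EuclideanSpace ℝ (Fin (L+1))) := by
    simp [Matrix.toLpLin_apply]
  have hOv := norm_toEuclideanLin_of_mem_orthogonalGroup hO (v : EuclideanSpace ℝ (Fin (L+1)))
  rw [hv] at hOv
  have hnorm : ‖(v : EuclideanSpace ℝ (Fin (L+1))) + a • Matrix.toEuclideanLin O v‖ =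
      √(1 + 2 * a * ⟪(v : EuclideanSpace ℝ (Fin (L+1))), Matrix.toEuclideanLin O v⟫ + a ^ 2) := by
    rw [← Real.sqrt_sq (norm_nonneg (_ + _)), norm_add_sq_real, inner_smul_right, norm_smul, hv,
      hOv, mul_one, Real.norm_eq_abs, sq_abs]
    ring_nf
  have hne : ¬ ‖Matrix.toEuclideanLin (1 + a • O) (v : EuclideanSpace ℝ (Fin (L+1)))‖ = 0 := by
    rw [hT, norm_eq_zero]
    intro h
    have h1 := congrArg norm (eq_neg_of_add_eq_zero_left h)
    rw [norm_neg, norm_smul, hv, hOv, Real.norm_eq_abs, abs_of_nonneg ha.1] at h1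
    linarith [ha.2]
  rw [actS, dif_neg hne]
  simp only [act]
  rw [hT, inner_smul_right, inner_add_right, inner_smul_right, real_inner_self_eq_norm_sq, hv,
    hnorm, overlap]
  ring

open scoped RealInnerProductSpace in
theorem stmt7 {L : ℕ} (hL : 2 ≤ L) {Ω : Type*} [MeasurableSpace Ω]
    (P : Measure Ω) [IsProbabilityMeasure P]
    (lam : ℝ) (hlam : lam ∈ Set.Ioo (0:ℝ) 1)
    (r : Ω → ℝ) (hr : Measurable r) (hr01 : ∀ ω, r ω ∈ Set.Icc (0:ℝ) 1)
    (U : Ω → Matrix (Fin (L+1)) (Fin (L+1)) ℝ) (hU : IsHaarOrth P U)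
    (hrU : IndepFun r U P) :
    ∀ v : Sph L, ∃ ϖac : Measure ℝ, ϖac ≪ (volume : Measure ℝ) ∧
      Measure.map (fun ω =>
        ⟪(v : EuclideanSpace ℝ (Fin (L+1))),
          (actS (1 + (lam * r ω) • U ω) v : EuclideanSpace ℝ (Fin (L+1)))⟫) P
        = P {ω | r ω = 0} • Measure.dirac (1:ℝ) + ϖac := by
  intro v
  have hUm := hU.1
  have hv : ‖(v : EuclideanSpace ℝ (Fin (L+1)))‖ = 1 := norm_eq_of_mem_sphere v
  set X : Ω → ℝ := fun ω => ⟪(v : EuclideanSpace ℝ (Fin (L+1))), Matrix.toEuclideanLin (U ω) v⟫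
  have hlin : Measurable fun A : Matrix (Fin (L+1)) (Fin (L+1)) ℝ =>
      ⟪(v : EuclideanSpace ℝ (Fin (L+1))), Matrix.toEuclideanLin A v⟫ :=
    (measurable_toEuclideanLin _).const_inner
  have hX : Measurable X := hlin.comp hUm
  have hXac : Measure.map X P ≪ volume := hU.map_inner_absolutelyContinuous (by omega) v
  have hX1 : ∀ ω, X ω ∈ Set.Icc (-1 : ℝ) 1 := fun ω => by
    have h := abs_real_inner_le_norm (v : EuclideanSpace ℝ (Fin (L+1)))
      (Matrix.toEuclideanLin (U ω) v)
    rw [norm_toEuclideanLin_of_mem_orthogonalGroup (hU.2.1 ω), hv, mul_one] at h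
    exact abs_le.1 h
  have hF : (fun ω => ⟪(v : EuclideanSpace ℝ (Fin (L+1))),
      (actS (1 + (lam * r ω) • U ω) v : EuclideanSpace ℝ (Fin (L+1)))⟫) =
      fun ω => overlap (lam * r ω) (X ω) := funext fun ω =>
    inner_actS_eq_overlap (hU.2.1 ω) ⟨mul_nonneg hlam.1.le (hr01 ω).1,
      by nlinarith [hlam.1, hlam.2, (hr01 ω).1, (hr01 ω).2]⟩ v
  have hFm : Measurable fun ω => overlap (lam * r ω) (X ω) :=
    measurable_overlap.comp ((hr.const_mul lam).prodMk hX)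
  have hr0 : MeasurableSet {ω | r ω = 0} := hr (measurableSet_singleton 0)
  have hind : IndepFun r X P := hrU.comp measurable_id hlin
  have hprod := hind.map_prod_eq_prod_map_map hr.aemeasurable hX.aemeasurable
  rw [hF]
  refine ⟨Measure.map (fun ω => overlap (lam * r ω) (X ω)) (P.restrict {ω | r ω = 0}ᶜ), ?_, ?_⟩
  · refine Measure.AbsolutelyContinuous.mk fun N hN hN0 => ?_
    rw [Measure.map_apply hFm hN, Measure.restrict_apply (hFm hN)]
    have hS : MeasurableSet {p : ℝ × ℝ | overlap (lam * p.1) p.2 ∈ N ∧ p.1 ∈ Set.Ioc (0 : ℝ) 1 ∧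
        p.2 ∈ Set.Icc (-1 : ℝ) 1} :=
      ((measurable_overlap.comp ((measurable_fst.const_mul lam).prodMk measurable_snd)) hN).inter
        ((measurable_fst measurableSet_Ioc).inter (measurable_snd measurableSet_Icc))
    have h0 : (Measure.map (fun ω => (r ω, X ω)) P) {p : ℝ × ℝ | overlap (lam * p.1) p.2 ∈ N ∧
        p.1 ∈ Set.Ioc (0 : ℝ) 1 ∧ p.2 ∈ Set.Icc (-1 : ℝ) 1} = 0 := by
      rw [hprod]
      refine Measure.measure_prod_null_of_ae_null hS (.of_forall fun ρ => ?_)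
      by_cases hρ : ρ ∈ Set.Ioc (0 : ℝ) 1
      · refine measure_mono_null (fun x hx => ?_) (hXac (volume_preimage_overlap_eq_zero
          (a := lam * ρ) ⟨mul_pos hlam.1 hρ.1, by nlinarith [hlam.1, hlam.2, hρ.1, hρ.2]⟩ hN hN0))
        exact ⟨hx.2.2, hx.1⟩
      · exact measure_mono_null (fun x hx => hρ hx.2.1) measure_empty
    rw [Measure.map_apply (hr.prodMk hX) hS] at h0
    refine measure_mono_null (fun ω hω => ?_) h0
    exact ⟨hω.1, ⟨lt_of_le_of_ne (hr01 ω).1 (Ne.symm hω.2), (hr01 ω).2⟩, hX1 ω⟩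
  · have h0 : Measure.map (fun ω => overlap (lam * r ω) (X ω)) (P.restrict {ω | r ω = 0}) =
        P {ω | r ω = 0} • Measure.dirac (1 : ℝ) := by
      rw [Measure.map_congr (g := fun _ => (1 : ℝ)), Measure.map_const, Measure.restrict_apply_univ]
      filter_upwards [ae_restrict_mem hr0] with ω hω
      have : r ω = 0 := hω
      simp [this, overlap]
    rw [← h0, ← Measure.map_add _ _ hFm, Measure.restrict_add_restrict_compl hr0]
end
end

section
/- For v ∈ 𝕊^L let ϱ_{r,λ,v}(A) = P((1+λrU)·v ∈ A) be the distribution on 𝕊^L of (1+λrU)·v. Then ϱ_{r,λ,v} = P(r = 0)·δ_v + ϱ^{ac}_{r,λ,v}, where δ_v is the Dirac measure at v and ϱ^{ac}_{r,λ,v} is absolutely continuous with respect to ν_L (so the pure point part equals P(r=0)·δ_v and the singular continuous part vanishes). Moreover the Radon–Nikodym density is symmetric: for all v, w ∈ 𝕊^L, (dϱ^{ac}_{r,λ,v}/dν_L)(w) = (dϱ^{ac}_{r,λ,w}/dν_L)(v) (for a suitable choice of the density, for ν_L⊗ν_L-almost every (v,w)). -/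
open MeasureTheory ProbabilityTheory Matrix Real
open scoped ENNReal

noncomputable section

section
variable {E : Type*} [NormedAddCommGroup E] [InnerProductSpace ℝ E]

lemma injOn_norm_smul_add_smul {v : E} (hv : ‖v‖ = 1) {a : ℝ} (ha : 0 < a) {s : Set E}
    (hs : ∀ x ∈ s, ∀ y ∈ s, inner ℝ v x + inner ℝ v y + a * (‖x‖ + ‖y‖) ≠ 0) :
    Set.InjOn (fun x : E => ‖x‖ • v + a • x) s := by
  intro x hx y hy hxy
  simp only at hxy
  obtain ⟨c, hc⟩ : ∃ c, c = (‖y‖ - ‖x‖) / a := ⟨_, rfl⟩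
  have hac : a * c = ‖y‖ - ‖x‖ := by rw [hc]; field_simp
  have h1 : x = y + c • v := by
    have : a • (x - (y + c • v)) = 0 := by
      rw [smul_sub, smul_add, smul_smul, hac, sub_smul]
      rw [← sub_eq_zero] at hxy
      rw [← hxy]; module
    rcases smul_eq_zero.1 this with h | h
    · exact absurd h ha.ne'
    · exact sub_eq_zero.1 h
  have h2 : ‖x‖ ^ 2 = ‖y‖ ^ 2 + 2 * (c * inner ℝ v y) + c ^ 2 := by
    rw [h1, norm_add_sq_real, inner_smul_right, norm_smul, hv, real_inner_comm]
    simp [sq_abs]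
  have h3 : inner ℝ v x = inner ℝ v y + c := by
    rw [h1, inner_add_right, inner_smul_right, real_inner_self_eq_norm_sq, hv]; ring
  have h4 : c * (inner ℝ v x + inner ℝ v y + a * (‖x‖ + ‖y‖)) = 0 := by
    linear_combination c * h3 - h2 + (‖x‖ + ‖y‖) * hac
  have h5 : c = 0 := (mul_eq_zero.1 h4).resolve_right (hs x hx y hy)
  rw [h1, h5]; simp

lemma hasFDerivAt_norm_smul_add_smul (v : E) (a : ℝ) {x : E} (hx : x ≠ 0) :
    HasFDerivAt (fun x : E => ‖x‖ • v + a • x)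
      ((‖x‖⁻¹ • innerSL ℝ x).smulRight v + a • ContinuousLinearMap.id ℝ E) x := by
  have h : HasFDerivAt (fun x : E => ‖x‖) (‖x‖⁻¹ • innerSL ℝ x) x := by
    have h1 := (hasStrictFDerivAt_norm_sq x).hasFDerivAt.sqrt (by simpa using hx)
    have hx' : ‖x‖ ≠ 0 := by simpa using hx
    simp only [Real.sqrt_sq (norm_nonneg _)] at h1
    convert h1 using 1
    ext y
    simp
    field_simp
  exact (h.smul_const v).add ((hasFDerivAt_id x).const_smul a)

variable [FiniteDimensional ℝ E]

lemma det_norm_smul_add_smul_ne_zero {v x : E} {a : ℝ} (ha : a ≠ 0)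
    (hx : inner ℝ v x + a * ‖x‖ ≠ 0) :
    ((‖x‖⁻¹ • innerSL ℝ x).smulRight v + a • ContinuousLinearMap.id ℝ E).det ≠ 0 := by
  intro hdet
  have h0 : x ≠ 0 := by rintro rfl; simp at hx
  have hn : ‖x‖ ≠ 0 := by simpa using h0
  obtain ⟨h, hh, hne⟩ := Submodule.exists_mem_ne_zero_of_ne_bot
    (LinearMap.bot_lt_ker_of_det_eq_zero hdet).ne'
  have h1 : (‖x‖⁻¹ * inner ℝ x h) • v + a • h = 0 := by simpa using hh
  have h2 : inner ℝ x h = 0 := by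
    have h3 := congrArg (fun z => inner ℝ x z) h1
    simp only [inner_add_right, inner_smul_right, inner_zero_right] at h3
    have h4 : inner ℝ x h * (inner ℝ v x + a * ‖x‖) = 0 := by
      rw [real_inner_comm x v] at *
      field_simp at h3
      linear_combination h3
    exact (mul_eq_zero.1 h4).resolve_right hx
  rw [h2] at h1
  exact hne (by simpa [ha] using h1)

variable [MeasurableSpace E] [BorelSpace E] (μ : Measure E) [μ.IsAddHaarMeasure]

lemma addHaar_inner_add_mul_norm_eq_zero {v : E} (hv : ‖v‖ = 1) {a : ℝ}
    (ha : a ∈ Set.Ioo (0 : ℝ) 1) :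
    μ {x | inner ℝ v x + a * ‖x‖ = 0} = 0 := by
  have hconv : Convex ℝ {x : E | inner ℝ v x + a * ‖x‖ ≤ 0} := by
    have : ConvexOn ℝ Set.univ (fun x : E => inner ℝ v x + a * ‖x‖) :=
      ((innerSL ℝ v).toLinearMap.convexOn convex_univ).add
        ((convexOn_norm convex_univ).smul ha.1.le)
    simpa using this.convex_le 0
  refine measure_mono_null ?_ (hconv.addHaar_frontier μ)
  intro x (hx : _ = _)
  refine ⟨subset_closure hx.le, fun hint => ?_⟩
  have hcont : Filter.Tendsto (fun t : ℝ => x + t • v) (nhdsWithin 0 (Set.Ioi 0)) (nhds x) := by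
    have : Continuous (fun t : ℝ => x + t • v) := by fun_prop
    have h := this.tendsto 0
    simp only [zero_smul, add_zero] at h
    exact h.mono_left nhdsWithin_le_nhds
  obtain ⟨t, ht, ht0⟩ := ((hcont.eventually (isOpen_interior.mem_nhds hint)).and
    self_mem_nhdsWithin).exists
  have h1 : inner ℝ v (x + t • v) + a * ‖x + t • v‖ ≤ 0 :=
    interior_subset (s := {x : E | inner ℝ v x + a * ‖x‖ ≤ 0}) ht
  have ht0 : 0 < t := ht0
  rw [inner_add_right, inner_smul_right, real_inner_self_eq_norm_sq, hv] at h1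
  have h2 : ‖x‖ ≤ ‖x + t • v‖ + t := by
    have := norm_sub_le (x + t • v) (t • v)
    rw [add_sub_cancel_right, norm_smul, hv, Real.norm_of_nonneg ht0.le] at this
    linarith
  nlinarith [ha.1, ha.2, mul_le_mul_of_nonneg_left h2 ha.1.le]

lemma addHaar_preimage_norm_smul_add_smul {v : E} (hv : ‖v‖ = 1) {a : ℝ}
    (ha : a ∈ Set.Ioo (0 : ℝ) 1) {N : Set E} (hN : MeasurableSet N) (hN0 : μ N = 0) :
    μ {x | ‖x‖ • v + a • x ∈ N} = 0 := by
  have hmN : MeasurableSet {x : E | ‖x‖ • v + a • x ∈ N} :=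
    (by fun_prop : Measurable (fun x : E => ‖x‖ • v + a • x)) hN
  have key : ∀ s : Set E, MeasurableSet s → (∀ x ∈ s, ‖x‖ • v + a • x ∈ N) →
      (∀ x ∈ s, inner ℝ v x + a * ‖x‖ ≠ 0) →
      (∀ x ∈ s, ∀ y ∈ s, inner ℝ v x + inner ℝ v y + a * (‖x‖ + ‖y‖) ≠ 0) → μ s = 0 := by
    intro s hs hsN hne hinj
    have hder : ∀ x ∈ s, HasFDerivWithinAt (fun x : E => ‖x‖ • v + a • x)
        ((‖x‖⁻¹ • innerSL ℝ x).smulRight v + a • ContinuousLinearMap.id ℝ E) s x :=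
      fun x hx => (hasFDerivAt_norm_smul_add_smul v a
        (by rintro rfl; simpa using hne 0 hx)).hasFDerivWithinAt
    have h := lintegral_abs_det_fderiv_eq_addHaar_image μ hs hder
      (injOn_norm_smul_add_smul hv ha.1 hinj)
    have h0 : μ ((fun x : E => ‖x‖ • v + a • x) '' s) = 0 :=
      measure_mono_null (Set.image_subset_iff.2 hsN) hN0
    rw [h0] at h
    by_contra hpos
    have hmeas := aemeasurable_ofReal_abs_det_fderivWithin μ hs hder
    rw [lintegral_eq_zero_iff' hmeas, Filter.EventuallyEq, ae_restrict_iff' hs] at h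
    refine hpos (measure_mono_null (fun x hx => ?_) h)
    simpa [hx] using det_norm_smul_add_smul_ne_zero ha.1.ne' (hne x hx)
  have hg : Measurable (fun x : E => inner ℝ v x + a * ‖x‖) := by fun_prop
  have hpos : μ ({x : E | ‖x‖ • v + a • x ∈ N} ∩ {x | 0 < inner ℝ v x + a * ‖x‖}) = 0 := by
    refine key _ (hmN.inter (measurableSet_lt measurable_const hg)) (fun x hx => hx.1)
      (fun x hx => hx.2.ne') (fun x hx y hy => ?_)
    have h1 : 0 < inner ℝ v x + a * ‖x‖ := hx.2
    have h2 : 0 < inner ℝ v y + a * ‖y‖ := hy.2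
    exact ne_of_gt (by linarith)
  have hneg : μ ({x : E | ‖x‖ • v + a • x ∈ N} ∩ {x | inner ℝ v x + a * ‖x‖ < 0}) = 0 := by
    refine key _ (hmN.inter (measurableSet_lt hg measurable_const)) (fun x hx => hx.1)
      (fun x hx => hx.2.ne) (fun x hx y hy => ?_)
    have h1 : inner ℝ v x + a * ‖x‖ < 0 := hx.2
    have h2 : inner ℝ v y + a * ‖y‖ < 0 := hy.2
    exact ne_of_lt (by linarith)
  refine measure_mono_null (fun x hx => ?_)
    (measure_union_null (measure_union_null hpos hneg)
      (addHaar_inner_add_mul_norm_eq_zero μ hv ha))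
  rcases lt_trichotomy (inner ℝ v x + a * ‖x‖) 0 with h | h | h
  · exact Or.inl (Or.inr ⟨hx, h⟩)
  · exact Or.inr h
  · exact Or.inl (Or.inl ⟨hx, h⟩)
end

variable {L : ℕ}

/-- The direction `x / ‖x‖` of a vector, with a default value `v` when `x = 0`. -/
def dirn (v : Sph L) (x : EuclideanSpace ℝ (Fin (L+1))) : Sph L :=
  if h : ‖x‖ = 0 then v
  else ⟨‖x‖⁻¹ • x, by
    rw [mem_sphere_zero_iff_norm, norm_smul, norm_inv, norm_norm, inv_mul_cancel₀ h]⟩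

lemma actS_eq_dirn (T : Matrix (Fin (L+1)) (Fin (L+1)) ℝ) (v : Sph L) :
    actS T v = dirn v (toEuclideanLin T v) := rfl

lemma coe_dirn (v : Sph L) (x : EuclideanSpace ℝ (Fin (L+1))) :
    (dirn v x : EuclideanSpace ℝ (Fin (L+1))) = if ‖x‖ = 0 then ↑v else ‖x‖⁻¹ • x := by
  unfold dirn; split_ifs <;> rfl

attribute [local irreducible] dirn actS

lemma coe_dirn_of_ne_zero (v : Sph L) {x : EuclideanSpace ℝ (Fin (L+1))} (hx : x ≠ 0) :
    (dirn v x : EuclideanSpace ℝ (Fin (L+1))) = ‖x‖⁻¹ • x := by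
  rw [coe_dirn, if_neg (by simpa using hx)]

lemma dirn_smul (v w : Sph L) {t : ℝ} (ht : 0 < t) {x : EuclideanSpace ℝ (Fin (L+1))}
    (hx : x ≠ 0) : dirn v (t • x) = dirn w x := by
  ext1
  rw [coe_dirn_of_ne_zero v (smul_ne_zero ht.ne' hx), coe_dirn_of_ne_zero w hx, norm_smul,
    Real.norm_of_nonneg ht.le, smul_smul]
  congr 1
  field_simp

lemma dirn_coe (v w : Sph L) : dirn v w = w := by
  have h : ‖(w : EuclideanSpace ℝ (Fin (L+1)))‖ = 1 := norm_eq_of_mem_sphere w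
  ext1
  rw [coe_dirn, h]
  simp

lemma measurable_dirn :
    Measurable fun p : Sph L × EuclideanSpace ℝ (Fin (L+1)) => dirn p.1 p.2 := by
  have h : Measurable fun p : Sph L × EuclideanSpace ℝ (Fin (L+1)) =>
      (dirn p.1 p.2 : EuclideanSpace ℝ (Fin (L+1))) := by
    simp only [coe_dirn]
    refine Measurable.ite ?_ (by fun_prop) (by fun_prop)
    exact (measurable_norm.comp measurable_snd) (measurableSet_singleton 0)
  exact h.subtype_mk (h := fun p => (dirn p.1 p.2).2)

lemma Measurable.dirn {α : Type*} [MeasurableSpace α] {f : α → Sph L}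
    {g : α → EuclideanSpace ℝ (Fin (L+1))} (hf : Measurable f) (hg : Measurable g) :
    Measurable fun a => dirn (f a) (g a) := by
  have h := measurable_dirn.comp (hf.prodMk hg)
  exact h

lemma measurable_dirn_right (v : Sph L) : Measurable (dirn v) :=
  measurable_dirn.comp measurable_prodMk_left

lemma measurable_toEuclideanLin_s9 :
    Measurable fun p : Matrix (Fin (L+1)) (Fin (L+1)) ℝ × EuclideanSpace ℝ (Fin (L+1)) =>
      toEuclideanLin p.1 p.2 := by
  have h1 : ∀ i j, Measurable fun M : Matrix (Fin (L+1)) (Fin (L+1)) ℝ => M i j :=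
    fun i j => (measurable_pi_apply j).comp (measurable_pi_apply i)
  have h2 : ∀ j, Measurable fun x : EuclideanSpace ℝ (Fin (L+1)) => x j := by
    intro j; fun_prop
  have h3 : Measurable fun p : Matrix (Fin (L+1)) (Fin (L+1)) ℝ × EuclideanSpace ℝ (Fin (L+1)) =>
      p.1 *ᵥ p.2.ofLp :=
    measurable_pi_lambda _ fun i => Finset.measurable_fun_sum Finset.univ fun j _ =>
      ((h1 i j).comp measurable_fst).mul ((h2 j).comp measurable_snd)
  simp only [toLpLin_apply]
  exact (WithLp.measurable_toLp 2 _).comp h3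

lemma Measurable.actS {α : Type*} [MeasurableSpace α]
    {f : α → Matrix (Fin (L+1)) (Fin (L+1)) ℝ} {g : α → Sph L}
    (hf : Measurable f) (hg : Measurable g) : Measurable fun a => actS (f a) (g a) := by
  have h : Measurable fun a => toEuclideanLin (f a) (g a : EuclideanSpace ℝ (Fin (L+1))) := by
    have h' := measurable_toEuclideanLin_s9.comp (hf.prodMk (measurable_subtype_coe.comp hg))
    exact h'
  simp only [actS_eq_dirn]
  exact hg.dirn h

lemma measurable_actS (T : Matrix (Fin (L+1)) (Fin (L+1)) ℝ) :
    Measurable (fun v : Sph L => actS T v) :=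
  Measurable.actS (f := fun _ => T) measurable_const measurable_id

lemma norm_toEuclideanLin {O : Matrix (Fin (L+1)) (Fin (L+1)) ℝ}
    (hO : O ∈ orthogonalGroup (Fin (L+1)) ℝ) (x : EuclideanSpace ℝ (Fin (L+1))) :
    ‖toEuclideanLin O x‖ = ‖x‖ := by
  have h : ‖toEuclideanLin O x‖ ^ 2 = ‖x‖ ^ 2 := by
    rw [← real_inner_self_eq_norm_sq, ← real_inner_self_eq_norm_sq]
    simp only [EuclideanSpace.inner_eq_star_dotProduct, toLpLin_apply]
    simp only [star_trivial]
    rw [dotProduct_mulVec, vecMul_mulVec, (mem_orthogonalGroup_iff' _ _).1 hO]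
    simp
  exact (pow_left_inj₀ (norm_nonneg _) (norm_nonneg _) two_ne_zero).1 h

lemma coe_actS {O : Matrix (Fin (L+1)) (Fin (L+1)) ℝ}
    (hO : O ∈ orthogonalGroup (Fin (L+1)) ℝ) (v : Sph L) :
    (actS O v : EuclideanSpace ℝ (Fin (L+1))) = toEuclideanLin O v := by
  have h : ‖(v : EuclideanSpace ℝ (Fin (L+1)))‖ = 1 := norm_eq_of_mem_sphere v
  rw [actS_eq_dirn, coe_dirn, norm_toEuclideanLin hO, h]
  simp

lemma actS_mul {O O' : Matrix (Fin (L+1)) (Fin (L+1)) ℝ}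
    (hO : O ∈ orthogonalGroup (Fin (L+1)) ℝ) (hO' : O' ∈ orthogonalGroup (Fin (L+1)) ℝ)
    (v : Sph L) : actS (O * O') v = actS O (actS O' v) := by
  ext1
  rw [coe_actS hO, coe_actS hO', coe_actS (mul_mem hO hO')]
  simp [toLpLin_apply]

lemma actS_dirn {O : Matrix (Fin (L+1)) (Fin (L+1)) ℝ}
    (hO : O ∈ orthogonalGroup (Fin (L+1)) ℝ) (v : Sph L) (x : EuclideanSpace ℝ (Fin (L+1))) :
    actS O (dirn v x) = dirn (actS O v) (toEuclideanLin O x) := by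
  ext1
  rw [coe_actS hO, coe_dirn, coe_dirn, norm_toEuclideanLin hO, coe_actS hO]
  split_ifs
  · rfl
  · rw [map_smul]

lemma transpose_mem_orthogonalGroup {O : Matrix (Fin (L+1)) (Fin (L+1)) ℝ}
    (hO : O ∈ orthogonalGroup (Fin (L+1)) ℝ) : Oᵀ ∈ orthogonalGroup (Fin (L+1)) ℝ := by
  rw [mem_orthogonalGroup_iff]
  simpa using (mem_orthogonalGroup_iff' _ _).1 hO

/-- The reflection exchanging two points of the sphere. -/
lemma exists_orthogonal_swap (v w : Sph L) :
    ∃ O ∈ orthogonalGroup (Fin (L+1)) ℝ, actS O v = w ∧ actS O w = v := by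
  let x : Fin (L+1) → ℝ := (v : EuclideanSpace ℝ (Fin (L+1))).ofLp
  let y : Fin (L+1) → ℝ := (w : EuclideanSpace ℝ (Fin (L+1))).ofLp
  have hself : ∀ u : Sph L, (u : EuclideanSpace ℝ (Fin (L+1))).ofLp ⬝ᵥ
      (u : EuclideanSpace ℝ (Fin (L+1))).ofLp = 1 := fun u => by
    have h := real_inner_self_eq_norm_sq (u : EuclideanSpace ℝ (Fin (L+1)))
    rw [norm_eq_of_mem_sphere u, EuclideanSpace.inner_eq_star_dotProduct] at h
    simpa using h
  have hx : x ⬝ᵥ x = 1 := hself v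
  have hy : y ⬝ᵥ y = 1 := hself w
  have hxy : y ⬝ᵥ x = x ⬝ᵥ y := dotProduct_comm _ _
  obtain ⟨d, hd⟩ : ∃ d, d = x - y := ⟨_, rfl⟩
  have hdx : d ⬝ᵥ x = 1 - x ⬝ᵥ y := by rw [hd, sub_dotProduct, hx, hxy]
  have hdy : d ⬝ᵥ y = x ⬝ᵥ y - 1 := by rw [hd, sub_dotProduct, hy]
  have hdd : d ⬝ᵥ d = 2 * (1 - x ⬝ᵥ y) := by
    conv_lhs => rw [hd, dotProduct_sub, ← hd, hdx, hdy]
    ring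
  obtain ⟨c, hc⟩ : ∃ c : ℝ, c = 2 / (d ⬝ᵥ d) := ⟨_, rfl⟩
  have hO : (1 - c • vecMulVec d d : Matrix (Fin (L+1)) (Fin (L+1)) ℝ) ∈
      orthogonalGroup (Fin (L+1)) ℝ := by
    rw [mem_orthogonalGroup_iff]
    have hcd : c * (c * (d ⬝ᵥ d) - 2) = 0 := by
      by_cases h : d ⬝ᵥ d = 0
      · simp [hc, h]
      · rw [hc]; field_simp; ring
    have h1 : (1 - c • vecMulVec d d : Matrix (Fin (L+1)) (Fin (L+1)) ℝ)ᵀ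
        = 1 - c • vecMulVec d d := by
      simp [transpose_vecMulVec]
    have h2 : vecMulVec d d * vecMulVec d d = (d ⬝ᵥ d) • vecMulVec d d := by
      rw [vecMulVec_mul_vecMulVec]
      simp
    rw [h1, sub_mul, mul_sub, mul_sub,
      smul_mul_smul_comm, h2, smul_smul]
    have h3 : (c * (c * (d ⬝ᵥ d) - 2)) • vecMulVec d d = 0 := by rw [hcd, zero_smul]
    simp only [mul_one, one_mul]
    rw [← sub_eq_zero, ← h3]
    module
  have hmul : ∀ z : Fin (L+1) → ℝ, (1 - c • vecMulVec d d) *ᵥ z = z - (c * (d ⬝ᵥ z)) • d := by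
    intro z
    rw [sub_mulVec, one_mulVec, smul_mulVec, vecMulVec_mulVec]
    simp [smul_smul]
  have hone : (c * (1 - x ⬝ᵥ y)) • d = d := by
    by_cases h : d ⬝ᵥ d = 0
    · rw [dotProduct_self_eq_zero.1 h, smul_zero]
    · have : c * (1 - x ⬝ᵥ y) = 1 := by
        rw [hc, div_mul_eq_mul_div, ← hdd, div_self h]
      rw [this, one_smul]
  refine ⟨_, hO, ?_, ?_⟩
  · ext1
    rw [coe_actS hO, toLpLin_apply]
    refine congrArg (WithLp.toLp 2) ((hmul x).trans ?_)
    rw [hdx, hone, hd]; exact sub_sub_cancel _ _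
  · ext1
    rw [coe_actS hO, toLpLin_apply]
    refine congrArg (WithLp.toLp 2) ((hmul y).trans ?_)
    have h : (c * (x ⬝ᵥ y - 1)) • d = -d := by
      conv_rhs => rw [← hone]
      module
    rw [hdy, h, hd]
    exact (sub_neg_eq_add _ _).trans (add_sub_cancel _ _)

lemma measurable_matrix_transpose :
    Measurable fun M : Matrix (Fin (L+1)) (Fin (L+1)) ℝ => Mᵀ :=
  measurable_pi_lambda _ fun i => measurable_pi_lambda _ fun j =>
    (measurable_pi_apply i).comp (measurable_pi_apply j)

lemma measurable_matrix_const_mul (O : Matrix (Fin (L+1)) (Fin (L+1)) ℝ) :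
    Measurable fun M : Matrix (Fin (L+1)) (Fin (L+1)) ℝ => O * M := by
  have h : ∀ i j, Measurable fun M : Matrix (Fin (L+1)) (Fin (L+1)) ℝ => M i j :=
    fun i j => (measurable_pi_apply j).comp (measurable_pi_apply i)
  refine measurable_pi_lambda _ fun i => measurable_pi_lambda _ fun j => ?_
  simp only [mul_apply]
  exact Finset.measurable_fun_sum Finset.univ fun k _ => (h k j).const_mul _

section Haar

variable {Ω : Type*} [MeasurableSpace Ω] {P : Measure Ω}
  {U : Ω → Matrix (Fin (L+1)) (Fin (L+1)) ℝ}

lemma IsHaarOrth.measure_transpose_mul (hU : IsHaarOrth P U)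
    {O : Matrix (Fin (L+1)) (Fin (L+1)) ℝ} (hO : O ∈ orthogonalGroup (Fin (L+1)) ℝ)
    {s : Set (Matrix (Fin (L+1)) (Fin (L+1)) ℝ)} (hs : MeasurableSet s) :
    P {ω | (U ω)ᵀ * O ∈ s} = P {ω | (U ω)ᵀ ∈ s} := by
  have hs' := measurable_matrix_transpose hs
  have h := congrArg (fun m => m ((fun M => Mᵀ) ⁻¹' s))
    (hU.2.2 _ (transpose_mem_orthogonalGroup hO))
  have hm : Measurable fun ω => Oᵀ * U ω := (measurable_matrix_const_mul _).comp hU.1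
  rw [Measure.map_apply hm hs',
    Measure.map_apply hU.1 hs'] at h
  simpa [Set.preimage, transpose_mul] using h

variable {X : Type*} [MeasurableSpace X] {a : Matrix (Fin (L+1)) (Fin (L+1)) ℝ → X → X}

lemma IsHaarOrth.measure_action_eq (hU : IsHaarOrth P U)
    (ha : Measurable (Function.uncurry a))
    (hmul : ∀ O ∈ orthogonalGroup (Fin (L+1)) ℝ, ∀ O' ∈ orthogonalGroup (Fin (L+1)) ℝ,
      ∀ x, a (O * O') x = a O (a O' x))
    {O : Matrix (Fin (L+1)) (Fin (L+1)) ℝ} (hO : O ∈ orthogonalGroup (Fin (L+1)) ℝ) (x : X)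
    {s : Set X} (hs : MeasurableSet s) :
    P {ω | a (U ω)ᵀ (a O x) ∈ s} = P {ω | a (U ω)ᵀ x ∈ s} := by
  have hm : MeasurableSet {M | a M x ∈ s} := by
    have h : Measurable fun M : Matrix (Fin (L+1)) (Fin (L+1)) ℝ => a M x :=
      ha.comp (measurable_id.prodMk measurable_const)
    exact h hs
  refine Eq.trans (congrArg P ?_) (hU.measure_transpose_mul hO hm)
  ext ω
  simp only [Set.mem_ofPred_eq, hmul _ (transpose_mem_orthogonalGroup (hU.2.1 ω)) _ hO]

lemma IsHaarOrth.measure_eq_lintegral [IsProbabilityMeasure P] (hU : IsHaarOrth P U)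
    (ha : Measurable (Function.uncurry a)) (m : Measure X) [SFinite m]
    (hinv : ∀ O ∈ orthogonalGroup (Fin (L+1)) ℝ, Measure.map (a O) m = m)
    {s : Set X} (hs : MeasurableSet s) :
    m s = ∫⁻ x, P {ω | a (U ω)ᵀ x ∈ s} ∂m := by
  have hmeas : Measurable fun p : Ω × X => a (U p.1)ᵀ p.2 :=
    ha.comp ((measurable_matrix_transpose.comp (hU.1.comp measurable_fst)).prodMk measurable_snd)
  have h1 := Measure.prod_apply (μ := P) (ν := m) (hmeas hs)
  rw [Measure.prod_apply_symm (hmeas hs)] at h1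
  refine Eq.trans ?_ h1.symm
  have h2 : ∀ ω, m (Prod.mk ω ⁻¹' ((fun p : Ω × X => a (U p.1)ᵀ p.2) ⁻¹' s)) = m s := by
    intro ω
    have h3 : Measurable (a (U ω)ᵀ) := ha.comp (measurable_const.prodMk measurable_id)
    conv_rhs => rw [← hinv _ (transpose_mem_orthogonalGroup (hU.2.1 ω)), Measure.map_apply h3 hs]
    rfl
  simp [h2]

lemma measurable_uncurry_actS : Measurable (Function.uncurry (actS (L := L))) := by
  have h := Measurable.actS (L := L) measurable_fst measurable_snd
  exact h

lemma IsHaarOrth.measure_eq_mul [IsProbabilityMeasure P] (hU : IsHaarOrth P U)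
    (m : Measure (Sph L)) [SFinite m]
    (hinv : ∀ O ∈ orthogonalGroup (Fin (L+1)) ℝ, Measure.map (actS O) m = m)
    (v : Sph L) {s : Set (Sph L)} (hs : MeasurableSet s) :
    m s = P {ω | actS (U ω)ᵀ v ∈ s} * m Set.univ := by
  rw [hU.measure_eq_lintegral measurable_uncurry_actS m hinv hs, ← lintegral_const]
  refine lintegral_congr fun x => ?_
  obtain ⟨O, hO, h, -⟩ := exists_orthogonal_swap v x
  rw [← h, hU.measure_action_eq measurable_uncurry_actS
    (fun O hO O' hO' v => actS_mul hO hO' v) hO v hs]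

lemma IsHaarOrth.map_actS [IsProbabilityMeasure P] (hU : IsHaarOrth P U)
    {ν : Measure (Sph L)} (hν : IsUniformSphere ν) (v : Sph L) :
    Measure.map (fun ω => actS (U ω) v) P = ν := by
  have := hν.1
  have hm : Measurable fun ω => actS (U ω) v := hU.1.actS measurable_const
  have : IsProbabilityMeasure (Measure.map (fun ω => actS (U ω) v) P) :=
    Measure.isProbabilityMeasure_map hm.aemeasurable
  have hinv : ∀ O ∈ orthogonalGroup (Fin (L+1)) ℝ,
      Measure.map (actS O) (Measure.map (fun ω => actS (U ω) v) P)
        = Measure.map (fun ω => actS (U ω) v) P := by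
    intro O hO
    have hv : Measurable fun M : Matrix (Fin (L+1)) (Fin (L+1)) ℝ => actS M v :=
      measurable_id.actS measurable_const
    have h := congrArg (Measure.map fun M => actS M v) (hU.2.2 O hO)
    have hm' : Measurable fun ω => O * U ω := (measurable_matrix_const_mul O).comp hU.1
    rw [Measure.map_map hv hm',
      Measure.map_map hv hU.1] at h
    rw [Measure.map_map (measurable_actS O) hm]
    refine Eq.trans (congrArg (fun g => Measure.map g P) ?_) h
    funext ω
    exact (actS_mul hO (hU.2.1 ω) v).symm
  ext s hs
  rw [hU.measure_eq_mul _ hinv v hs, hU.measure_eq_mul ν hν.2 v hs]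
  simp

lemma IsHaarOrth.map_swap_eq [IsProbabilityMeasure P] (hU : IsHaarOrth P U)
    (m : Measure (Sph L × Sph L)) [SFinite m]
    (hinv : ∀ O ∈ orthogonalGroup (Fin (L+1)) ℝ,
      Measure.map (Prod.map (actS O) (actS O)) m = m) :
    Measure.map Prod.swap m = m := by
  have ha : Measurable (Function.uncurry fun M : Matrix (Fin (L+1)) (Fin (L+1)) ℝ =>
      (Prod.map (actS M) (actS M) : Sph L × Sph L → Sph L × Sph L)) := by
    have h1 := Measurable.actS (L := L) measurable_fst
      ((measurable_fst (β := Sph L)).comp measurable_snd)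
    have h2 := Measurable.actS (L := L) measurable_fst
      ((measurable_snd (α := Sph L)).comp measurable_snd)
    exact h1.prodMk h2
  ext s hs
  rw [Measure.map_apply measurable_swap hs,
    hU.measure_eq_lintegral ha m hinv (measurable_swap hs), hU.measure_eq_lintegral ha m hinv hs]
  refine lintegral_congr fun x => ?_
  obtain ⟨O, hO, h, h'⟩ := exists_orthogonal_swap x.1 x.2
  rw [← hU.measure_action_eq ha (fun O hO O' hO' v => by
    simp [Prod.map, actS_mul hO hO']) hO x hs]
  simp [Prod.map, h, h']

end Haar

lemma addHaar_map_dirn_invariant (v : Sph L) (R : ℝ)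
    {O : Matrix (Fin (L+1)) (Fin (L+1)) ℝ} (hO : O ∈ orthogonalGroup (Fin (L+1)) ℝ) :
    Measure.map (actS O) (Measure.map (dirn v) (volume.restrict (Metric.ball 0 R)))
      = Measure.map (dirn v) (volume.restrict (Metric.ball 0 R)) := by
  have hd := measurable_dirn_right v
  let T : EuclideanSpace ℝ (Fin (L+1)) →ₗᵢ[ℝ] EuclideanSpace ℝ (Fin (L+1)) :=
    ⟨toEuclideanLin O, norm_toEuclideanLin hO⟩
  have hT : MeasurePreserving T volume volume :=
    (T.toLinearIsometryEquiv rfl).measurePreserving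
  have hT' : MeasurePreserving T (volume.restrict (Metric.ball 0 R))
      (volume.restrict (Metric.ball 0 R)) := by
    have h := hT.restrict_preimage (s := Metric.ball 0 R) Metric.isOpen_ball.measurableSet
    have h2 : T ⁻¹' Metric.ball 0 R = Metric.ball 0 R := by
      ext x
      simp
    rwa [h2] at h
  rw [Measure.map_map (measurable_actS O) hd]
  conv_rhs => rw [← hT'.map_eq, Measure.map_map hd hT'.measurable]
  refine Measure.map_congr (ae_restrict_of_ae ?_)
  have h0 : ∀ᵐ x : EuclideanSpace ℝ (Fin (L+1)), x ≠ 0 := by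
    simp [ae_iff]
  filter_upwards [h0] with x hx
  have hTx : T x ≠ 0 := by
    rw [ne_eq, ← norm_eq_zero, T.norm_map, norm_eq_zero]; exact hx
  have h1 := dirn_smul (actS O v) v one_pos hTx
  rw [one_smul] at h1
  exact (actS_dirn hO v x).trans h1

lemma IsUniformSphere.null_iff {Ω : Type*} [MeasurableSpace Ω] {P : Measure Ω}
    [IsProbabilityMeasure P] {U : Ω → Matrix (Fin (L+1)) (Fin (L+1)) ℝ} (hU : IsHaarOrth P U)
    {ν : Measure (Sph L)} (hν : IsUniformSphere ν) (v : Sph L) {R : ℝ} (hR : 0 < R)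
    {s : Set (Sph L)} (hs : MeasurableSet s) :
    ν s = 0 ↔ volume (dirn v ⁻¹' s ∩ Metric.ball 0 R) = 0 := by
  have := hν.1
  have hd := measurable_dirn_right v
  have hfin : IsFiniteMeasure
      ((volume : Measure (EuclideanSpace ℝ (Fin (L+1)))).restrict (Metric.ball 0 R)) :=
    ⟨by simpa using measure_ball_lt_top⟩
  have h1 := hU.measure_eq_mul ν hν.2 v hs
  have h2 := hU.measure_eq_mul _ (fun O hO => addHaar_map_dirn_invariant v R hO) v hs
  rw [Measure.map_apply hd hs, Measure.map_apply hd MeasurableSet.univ,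
    Measure.restrict_apply (hd hs)] at h2
  rw [measure_univ, mul_one] at h1
  rw [h2, h1, mul_eq_zero, or_iff_left]
  simpa using (Metric.measure_ball_pos volume _ hR).ne'

lemma IsUniformSphere.null_preimage {Ω : Type*} [MeasurableSpace Ω] {P : Measure Ω}
    [IsProbabilityMeasure P] {U : Ω → Matrix (Fin (L+1)) (Fin (L+1)) ℝ} (hU : IsHaarOrth P U)
    {ν : Measure (Sph L)} (hν : IsUniformSphere ν) (v : Sph L) {a : ℝ}
    (ha : a ∈ Set.Ioo (0 : ℝ) 1) {s : Set (Sph L)} (hs : MeasurableSet s) (h0 : ν s = 0) :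
    ν {u | dirn v ((v : EuclideanSpace ℝ (Fin (L+1))) + a • (u : EuclideanSpace ℝ (Fin (L+1))))
      ∈ s} = 0 := by
  have hv : ‖(v : EuclideanSpace ℝ (Fin (L+1)))‖ = 1 := norm_eq_of_mem_sphere v
  have hd := measurable_dirn_right v
  have hm : MeasurableSet {u : Sph L | dirn v ((v : EuclideanSpace ℝ (Fin (L+1))) +
      a • (u : EuclideanSpace ℝ (Fin (L+1)))) ∈ s} := by
    have h : Measurable fun u : Sph L => (v : EuclideanSpace ℝ (Fin (L+1))) +
      a • (u : EuclideanSpace ℝ (Fin (L+1))) := by fun_prop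
    exact (hd.comp h) hs
  rw [hν.null_iff hU v one_pos hm]
  rw [hν.null_iff hU v two_pos hs] at h0
  have h1 := addHaar_preimage_norm_smul_add_smul volume hv ha
    ((hd hs).inter Metric.isOpen_ball.measurableSet) h0
  refine measure_mono_null ?_ (measure_union_null (measure_singleton 0) h1)
  rintro x ⟨hx, hx1⟩
  by_cases hx0 : x = 0
  · exact Or.inl hx0
  right
  have hn : 0 < ‖x‖ := norm_pos_iff.2 hx0
  have hx1 : ‖x‖ < 1 := by simpa using hx1
  have hne : (v : EuclideanSpace ℝ (Fin (L+1))) + a • (‖x‖⁻¹ • x) ≠ 0 := by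
    intro h
    have h2 : ‖a • (‖x‖⁻¹ • x)‖ = 1 := by
      rw [eq_neg_of_add_eq_zero_right h, norm_neg, hv]
    rw [norm_smul, norm_smul, norm_inv, norm_norm, inv_mul_cancel₀ hn.ne', mul_one,
      Real.norm_of_nonneg ha.1.le] at h2
    linarith [ha.2]
  have heq : ‖x‖ • (v : EuclideanSpace ℝ (Fin (L+1))) + a • x
      = ‖x‖ • ((v : EuclideanSpace ℝ (Fin (L+1))) + a • (‖x‖⁻¹ • x)) := by
    rw [smul_add, smul_comm ‖x‖ a, smul_inv_smul₀ hn.ne']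
  have hx : dirn v ((v : EuclideanSpace ℝ (Fin (L+1))) +
    a • (dirn v x : EuclideanSpace ℝ (Fin (L+1)))) ∈ s := hx
  rw [coe_dirn_of_ne_zero v hx0] at hx
  refine ⟨?_, ?_⟩
  · rw [Set.mem_preimage, heq, dirn_smul v v hn hne]
    exact hx
  · rw [mem_ball_zero_iff]
    refine (norm_add_le _ _).trans_lt ?_
    rw [norm_smul, norm_smul, hv, norm_norm, Real.norm_of_nonneg ha.1.le]
    nlinarith [ha.1, ha.2]

theorem stmt9 {L : ℕ} (hL : 2 ≤ L) {Ω : Type*} [MeasurableSpace Ω]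
    (P : Measure Ω) [IsProbabilityMeasure P]
    (lam : ℝ) (hlam : lam ∈ Set.Ioo (0:ℝ) 1)
    (r : Ω → ℝ) (hr : Measurable r) (hr01 : ∀ ω, r ω ∈ Set.Icc (0:ℝ) 1)
    (U : Ω → Matrix (Fin (L+1)) (Fin (L+1)) ℝ) (hU : IsHaarOrth P U)
    (hrU : IndepFun r U P)
    (ν : Measure (Sph L)) (hν : IsUniformSphere ν) :
    ∃ f : Sph L → Sph L → ℝ≥0∞,
      (∀ v : Sph L,
        Measure.map (fun ω => actS (1 + (lam * r ω) • U ω) v) P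
          = P {ω | r ω = 0} • Measure.dirac v + ν.withDensity (f v)) ∧
      (∀ᵐ p ∂(ν.prod ν), f p.1 p.2 = f p.2 p.1) := by
  have hνp := hν.1
  let ρ : Measure ℝ := P.map r
  have hρ : IsProbabilityMeasure ρ := Measure.isProbabilityMeasure_map hr.aemeasurable
  let ρ' : Measure ℝ := ρ.restrict {0}ᶜ
  let g : Sph L × ℝ × Sph L → Sph L := fun p =>
    dirn p.1 ((p.1 : EuclideanSpace ℝ (Fin (L+1))) +
      (lam * p.2.1) • (p.2.2 : EuclideanSpace ℝ (Fin (L+1))))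
  have hg : Measurable g := by
    have h : Measurable fun p : Sph L × ℝ × Sph L => (p.1 : EuclideanSpace ℝ (Fin (L+1))) +
      (lam * p.2.1) • (p.2.2 : EuclideanSpace ℝ (Fin (L+1))) := by fun_prop
    exact measurable_fst.dirn h
  have hgv : ∀ v, Measurable fun q => g (v, q) := fun v => hg.comp measurable_prodMk_left
  let κ : Kernel (Sph L) (Sph L) :=
    (Kernel.deterministic id measurable_id ×ₖ Kernel.const (Sph L) (ρ'.prod ν)).map g
  have hκfin : IsFiniteKernel κ := by
    have : IsFiniteMeasure ρ' := by infer_instance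
    exact Kernel.IsFiniteKernel.map _ _
  have hκ : ∀ v, κ v = Measure.map (fun q => g (v, q)) (ρ'.prod ν) := by
    intro v
    rw [Kernel.map_apply _ hg, Kernel.prod_apply, Kernel.deterministic_apply, Kernel.const_apply,
      id, Measure.dirac_prod, Measure.map_map hg measurable_prodMk_left]
    rfl
  have hac : ∀ v, κ v ≪ ν := by
    intro v
    refine Measure.AbsolutelyContinuous.mk fun s hs h0 => ?_
    rw [hκ, Measure.map_apply (hgv v) hs, Measure.prod_apply (hgv v hs)]
    have hpos : ∀ᵐ c ∂ρ', c ∈ Set.Ioc (0 : ℝ) 1 := by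
      have h : ∀ᵐ c ∂ρ, c ∈ Set.Icc (0 : ℝ) 1 :=
        (ae_map_iff hr.aemeasurable measurableSet_Icc).2 (ae_of_all _ hr01)
      filter_upwards [ae_restrict_of_ae h,
        ae_restrict_mem (measurableSet_singleton (0 : ℝ)).compl] with c hc hc0
      exact ⟨lt_of_le_of_ne hc.1 (Ne.symm hc0), hc.2⟩
    rw [lintegral_eq_zero_iff (measurable_measure_prodMk_left (hgv v hs))]
    filter_upwards [hpos] with c hc
    exact hν.null_preimage hU v ⟨mul_pos hlam.1 hc.1, by nlinarith [hlam.1, hlam.2, hc.1, hc.2]⟩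
      hs h0
  have hwd : ∀ v, ν.withDensity (κ.rnDeriv (Kernel.const _ ν) v) = κ v := by
    intro v
    have h := Kernel.withDensity_rnDeriv_eq (κ := κ) (η := Kernel.const _ ν) (a := v)
      (by simpa using hac v)
    rwa [Kernel.withDensity_apply _ (Kernel.measurable_rnDeriv _ _), Kernel.const_apply] at h
  refine ⟨fun v => κ.rnDeriv (Kernel.const _ ν) v, fun v => ?_, ?_⟩
  · have hUv : Measurable fun ω => actS (U ω) v := hU.1.actS measurable_const
    have hpair : Measure.map (fun ω => (r ω, actS (U ω) v)) P = ρ.prod ν := by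
      have hind : IndepFun r (fun ω => actS (U ω) v) P := by
        have hv : Measurable fun M : Matrix (Fin (L+1)) (Fin (L+1)) ℝ => actS M v :=
          measurable_id.actS measurable_const
        exact hrU.comp measurable_id hv
      rw [(indepFun_iff_map_prod_eq_prod_map_map hr.aemeasurable hUv.aemeasurable).1 hind,
        hU.map_actS hν v]
    have hfun : (fun ω => actS (1 + (lam * r ω) • U ω) v)
        = (fun q => g (v, q)) ∘ fun ω => (r ω, actS (U ω) v) := by
      funext ω
      simp only [g, Function.comp, actS_eq_dirn (1 + _), coe_actS (hU.2.1 ω)]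
      congr 1
      simp
    have hsplit : ρ = P {ω | r ω = 0} • Measure.dirac 0 + ρ' := by
      rw [← Measure.restrict_add_restrict_compl (measurableSet_singleton (0 : ℝ)) (μ := ρ),
        Measure.restrict_singleton, Measure.map_apply hr (measurableSet_singleton 0)]
      rfl
    rw [hwd, hκ, hfun, ← Measure.map_map (hgv v) (hr.prodMk hUv), hpair, hsplit,
      Measure.add_prod, Measure.map_add _ _ (hgv v), Measure.prod_smul_left, Measure.map_smul,
      Measure.dirac_prod, Measure.map_map (hgv v) measurable_prodMk_left]
    congr 2
    have hconst : (fun q => g (v, q)) ∘ Prod.mk (0 : ℝ) = fun _ => v := by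
      funext u
      simp [g, dirn_coe]
    rw [hconst, Measure.map_const]
    simp
  · have hjoint := Kernel.measurable_rnDeriv κ (Kernel.const _ ν)
    have hfin : IsFiniteMeasure ρ' := by infer_instance
    let h : Sph L × ℝ × Sph L → Sph L × Sph L := fun p => (p.1, g p)
    have hh : Measurable h := measurable_fst.prodMk hg
    have hM : (ν.prod ν).withDensity (fun p => κ.rnDeriv (Kernel.const _ ν) p.1 p.2)
        = Measure.map h (ν.prod (ρ'.prod ν)) := by
      ext s hs
      rw [withDensity_apply _ hs, Measure.map_apply hh hs, Measure.prod_apply (hh hs),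
        ← lintegral_indicator hs, lintegral_prod _ ((hjoint.indicator hs).aemeasurable)]
      refine lintegral_congr fun v => ?_
      have hsv : MeasurableSet (Prod.mk v ⁻¹' s) := measurable_prodMk_left hs
      have h1 : (κ v) (Prod.mk v ⁻¹' s) = (ρ'.prod ν) (Prod.mk v ⁻¹' (h ⁻¹' s)) := by
        rw [hκ, Measure.map_apply (hgv v) hsv]
        rfl
      rw [← h1, ← hwd, withDensity_apply _ hsv, ← lintegral_indicator hsv]
      rfl
    have hinv : ∀ O ∈ orthogonalGroup (Fin (L+1)) ℝ,
        Measure.map (Prod.map (actS O) (actS O)) (Measure.map h (ν.prod (ρ'.prod ν)))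
          = Measure.map h (ν.prod (ρ'.prod ν)) := by
      intro O hO
      have hO' : MeasurePreserving (actS O) ν ν := ⟨measurable_actS O, hν.2 O hO⟩
      have hN := hO'.prod ((MeasurePreserving.id ρ').prod hO')
      rw [Measure.map_map ((measurable_actS O).prodMap (measurable_actS O)) hh]
      conv_rhs => rw [← hN.map_eq, Measure.map_map hh hN.measurable]
      refine congrArg (fun k => Measure.map k _) ?_
      funext p
      simp [h, g, Prod.map, actS_dirn hO, coe_actS hO]
    have hswap := hU.map_swap_eq _ hinv
    rw [← hM] at hswap
    have hswap' : (ν.prod ν).withDensity (fun p => κ.rnDeriv (Kernel.const _ ν) p.2 p.1)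
        = (ν.prod ν).withDensity (fun p => κ.rnDeriv (Kernel.const _ ν) p.1 p.2) := by
      conv_rhs => rw [← hswap]
      ext s hs
      rw [Measure.map_apply measurable_swap hs, withDensity_apply _ hs,
        withDensity_apply _ (measurable_swap hs)]
      exact ((Measure.measurePreserving_swap (μ := ν) (ν := ν)).setLIntegral_comp_preimage hs
        (hjoint.comp measurable_swap)).symm
    exact ((withDensity_eq_iff_of_sigmaFinite (hjoint.comp measurable_swap).aemeasurable
      hjoint.aemeasurable).1 hswap').symm
end
end

section
/- Let λ ∈ (0, 1/4] and L ≥ 3. Then for all v ∈ 𝕊^L one has E‖𝔞((1+λrU)·v)‖² ≤ ‖𝔞(v)‖² + λ²·3L_𝔞/(L+1). -/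
open MeasureTheory ProbabilityTheory Matrix Real
open scoped ENNReal

noncomputable section

/-- The proportion of the squared norm of `x + s • w` carried by the coordinates in `S`. -/
def sqRatio {n : ℕ} (S : Finset (Fin n)) (x : Fin n → ℝ) (s : ℝ) (w : Fin n → ℝ) : ℝ :=
  (∑ k ∈ S, (x k + s * w k) ^ 2) / ∑ k, (x k + s * w k) ^ 2

lemma sum_add_mul_sq {n : ℕ} (S : Finset (Fin n)) (x w : Fin n → ℝ) (s : ℝ) :
    ∑ k ∈ S, (x k + s * w k) ^ 2
      = ∑ k ∈ S, x k ^ 2 + 2 * s * ∑ k ∈ S, x k * w k + s ^ 2 * ∑ k ∈ S, w k ^ 2 := by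
  simp only [Finset.mul_sum, ← Finset.sum_add_distrib]
  exact Finset.sum_congr rfl fun k _ => by ring

lemma one_sub_sq_le_sum_add_mul_sq {n : ℕ} {x w : Fin n → ℝ} (hx : ∑ k, x k ^ 2 = 1)
    (hw : ∑ k, w k ^ 2 = 1) {s : ℝ} (hs : 0 ≤ s) :
    (1 - s) ^ 2 ≤ ∑ k, (x k + s * w k) ^ 2 := by
  have h : 0 ≤ ∑ k, (x k + 1 * w k) ^ 2 := Finset.sum_nonneg fun k _ => sq_nonneg _
  rw [sum_add_mul_sq, hx, hw] at h ⊢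
  nlinarith

lemma sqRatio_nonneg {n : ℕ} (S : Finset (Fin n)) (x : Fin n → ℝ) (s : ℝ) (w : Fin n → ℝ) :
    0 ≤ sqRatio S x s w :=
  div_nonneg (Finset.sum_nonneg fun _ _ => sq_nonneg _) (Finset.sum_nonneg fun _ _ => sq_nonneg _)

lemma sqRatio_le_one {n : ℕ} (S : Finset (Fin n)) (x : Fin n → ℝ) (s : ℝ) (w : Fin n → ℝ) :
    sqRatio S x s w ≤ 1 :=
  div_le_one_of_le₀
    (Finset.sum_le_sum_of_subset_of_nonneg (Finset.subset_univ S) fun _ _ _ => sq_nonneg _)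
    (Finset.sum_nonneg fun _ _ => sq_nonneg _)

/-- Averaging over `w` and its reflection `2 ⟨x, w⟩ x - w` cancels the first order in `s`. -/
lemma sqRatio_add_sqRatio_reflection_le {n : ℕ} (S : Finset (Fin n)) {x w w' : Fin n → ℝ}
    (hx : ∑ k, x k ^ 2 = 1) (hw : ∑ k, w k ^ 2 = 1) (hw'1 : ∑ k, w' k ^ 2 = 1)
    (hw' : ∀ k, w' k = 2 * (∑ j, x j * w j) * x k - w k) {s l : ℝ} (hs : 0 ≤ s) (hsl : s ≤ l)
    (hl : l ≤ 1 / 4) :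
    sqRatio S x s w + sqRatio S x s w'
      ≤ 2 * ∑ k ∈ S, x k ^ 2 + l ^ 2 * 3 * (∑ k ∈ S, w k ^ 2 + ∑ k ∈ S, w' k ^ 2) := by
  have hB (T : Finset (Fin n)) : ∑ k ∈ T, x k * w' k
      = 2 * (∑ j, x j * w j) * ∑ k ∈ T, x k ^ 2 - ∑ k ∈ T, x k * w k := by
    rw [Finset.mul_sum, ← Finset.sum_sub_distrib]
    exact Finset.sum_congr rfl fun k _ => by rw [hw']; ring
  have hD := one_sub_sq_le_sum_add_mul_sq hx hw hs
  have hA : 0 ≤ ∑ k ∈ S, x k ^ 2 := Finset.sum_nonneg fun k _ => sq_nonneg _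
  have hC : 0 ≤ ∑ k ∈ S, w k ^ 2 := Finset.sum_nonneg fun k _ => sq_nonneg _
  have hC' : 0 ≤ ∑ k ∈ S, w' k ^ 2 := Finset.sum_nonneg fun k _ => sq_nonneg _
  simp only [sqRatio, sum_add_mul_sq, hB, hx, hw, hw'1] at hD ⊢
  generalize ∑ k ∈ S, x k ^ 2 = A at *
  generalize ∑ k ∈ S, w k ^ 2 = C at *
  generalize ∑ k ∈ S, w' k ^ 2 = C' at *
  generalize ∑ k ∈ S, x k * w k = B at *
  generalize ∑ k, x k * w k = t at *
  have hD' : 1 / 3 ≤ 1 + 2 * s * t + s ^ 2 := by nlinarith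
  have hden : 1 + 2 * s * (2 * t * 1 - t) + s ^ 2 * 1 = 1 + 2 * s * t + s ^ 2 := by ring
  rw [hden, mul_one (s ^ 2), ← add_div, div_le_iff₀ (by linarith)]
  have h1 : s ^ 2 * (C + C') ≤ l ^ 2 * (C + C') := by gcongr
  have h2 : 0 ≤ l ^ 2 * (C + C') := by positivity
  have h3 : 0 ≤ s ^ 2 * A := by positivity
  nlinarith [mul_le_mul_of_nonneg_left hD' h2]

lemma sum_mulVec_sq_of_mem_orthogonalGroup {n : ℕ} {M : Matrix (Fin n) (Fin n) ℝ}
    (hM : M ∈ orthogonalGroup (Fin n) ℝ) (x : Fin n → ℝ) :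
    ∑ k, (M *ᵥ x) k ^ 2 = ∑ k, x k ^ 2 := by
  have h : (M *ᵥ x) ⬝ᵥ (M *ᵥ x) = x ⬝ᵥ x := by
    rw [dotProduct_mulVec, vecMul_mulVec, (mem_orthogonalGroup_iff' ..).1 hM, vecMul_one]
  simpa [dotProduct, sq] using h

lemma two_smul_vecMulVec_sub_one_mem_orthogonalGroup {n : ℕ} {x : Fin n → ℝ}
    (hx : ∑ k, x k ^ 2 = 1) :
    (2 : ℝ) • vecMulVec x x - 1 ∈ orthogonalGroup (Fin n) ℝ := by
  have hx' : x ⬝ᵥ x = 1 := by simpa [dotProduct, sq] using hx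
  rw [mem_orthogonalGroup_iff]
  have htr : ((2 : ℝ) • vecMulVec x x - 1)ᵀ = (2 : ℝ) • vecMulVec x x - 1 := by
    ext i j
    simp [vecMulVec_apply, one_apply, mul_comm, eq_comm]
  rw [htr]
  simp [mul_sub, sub_mul, vecMulVec_mul_vecMulVec, hx']
  module

lemma two_smul_vecMulVec_sub_one_mulVec {n : ℕ} (x w : Fin n → ℝ) (k : Fin n) :
    (((2 : ℝ) • vecMulVec x x - 1) *ᵥ w) k = 2 * (∑ j, x j * w j) * x k - w k := by
  simp [sub_mulVec, smul_mulVec, vecMulVec_mulVec, dotProduct]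
  ring

lemma naSq_actS_one_add_smul {L : ℕ} (La : ℕ) {M : Matrix (Fin (L + 1)) (Fin (L + 1)) ℝ}
    (hM : M ∈ orthogonalGroup (Fin (L + 1)) ℝ) {s : ℝ} (hs : 0 ≤ s) (hs1 : s < 1) (v : Sph L)
    (hv : ∑ k, v.1 k ^ 2 = 1) :
    naSq La (actS (1 + s • M) v : Sph L).1
      = sqRatio (Finset.univ.filter fun k : Fin (L + 1) => (k : ℕ) < La) v.1 s (M *ᵥ v.1) := by
  have hT (k : Fin (L + 1)) :
      toEuclideanLin (1 + s • M) v.1 k = v.1 k + s * (M *ᵥ v.1) k := by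
    simp [toLpLin_apply]
  have hnorm : ‖toEuclideanLin (1 + s • M) v.1‖ ^ 2
      = ∑ k, (v.1 k + s * (M *ᵥ v.1) k) ^ 2 := by
    simp only [EuclideanSpace.real_norm_sq_eq, hT]
  have hpos := one_sub_sq_le_sum_add_mul_sq hv
    ((sum_mulVec_sq_of_mem_orthogonalGroup hM v.1).trans hv) hs
  have hne : ‖toEuclideanLin (1 + s • M) v.1‖ ≠ 0 := by
    intro h
    rw [← hnorm, h] at hpos
    nlinarith [sub_pos.2 hs1]
  rw [actS, dif_neg hne, sqRatio, ← hnorm, naSq, Finset.sum_filter, Finset.sum_div]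
  refine Finset.sum_congr rfl fun k _ => ?_
  split_ifs
  · simp only [act, PiLp.smul_apply, hT, smul_eq_mul, inv_mul_eq_div, div_pow]
  · simp

lemma measurable_matrix_entry {n : ℕ} (i j : Fin n) :
    Measurable fun M : Matrix (Fin n) (Fin n) ℝ => M i j :=
  (measurable_pi_apply j).comp (measurable_pi_apply (X := fun _ => Fin n → ℝ) i)

lemma measurable_matrix_mul_left {n : ℕ} (O : Matrix (Fin n) (Fin n) ℝ) :
    Measurable fun M : Matrix (Fin n) (Fin n) ℝ => O * M := by
  refine measurable_pi_iff.2 fun i => measurable_pi_iff.2 fun j => ?_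
  simp only [mul_apply]
  exact Finset.measurable_sum _ fun k _ => (measurable_matrix_entry k j).const_mul _

lemma measurable_mulVec_apply {n : ℕ} (x : Fin n → ℝ) (k : Fin n) :
    Measurable fun M : Matrix (Fin n) (Fin n) ℝ => (M *ᵥ x) k := by
  simp only [mulVec, dotProduct]
  exact Finset.measurable_sum _ fun j _ => (measurable_matrix_entry k j).mul_const _

lemma measurable_sqRatio_mulVec {n : ℕ} (S : Finset (Fin n)) (x : Fin n → ℝ) (l : ℝ) :
    Measurable fun p : ℝ × Matrix (Fin n) (Fin n) ℝ => sqRatio S x (l * p.1) (p.2 *ᵥ x) := by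
  have h (k : Fin n) : Measurable fun p : ℝ × Matrix (Fin n) (Fin n) ℝ =>
      (x k + l * p.1 * (p.2 *ᵥ x) k) ^ 2 :=
    (((measurable_fst.const_mul l).mul
      ((measurable_mulVec_apply x k).comp measurable_snd)).const_add _).pow_const 2
  exact (Finset.measurable_sum _ fun k _ => h k).div (Finset.measurable_sum _ fun k _ => h k)

namespace IsHaarOrth

variable {L : ℕ} {Ω : Type*} [MeasurableSpace Ω] {P : Measure Ω} [IsProbabilityMeasure P]
  {U : Ω → Matrix (Fin (L + 1)) (Fin (L + 1)) ℝ} {O : Matrix (Fin (L + 1)) (Fin (L + 1)) ℝ}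

lemma integral_comp_mul_left (hU : IsHaarOrth P U)
    (hO : O ∈ orthogonalGroup (Fin (L + 1)) ℝ) {r : Ω → ℝ} (hr : Measurable r)
    (hrU : IndepFun r U P) {f : ℝ × Matrix (Fin (L + 1)) (Fin (L + 1)) ℝ → ℝ}
    (hf : Measurable f) :
    ∫ ω, f (r ω, O * U ω) ∂P = ∫ ω, f (r ω, U ω) ∂P := by
  have hOU : Measurable fun ω => O * U ω := (measurable_matrix_mul_left O).comp hU.1
  have hrOU : IndepFun r (fun ω => O * U ω) P :=
    hrU.comp measurable_id (measurable_matrix_mul_left O)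
  have hmap : P.map (fun ω => (r ω, O * U ω)) = P.map (fun ω => (r ω, U ω)) := by
    rw [(indepFun_iff_map_prod_eq_prod_map_map hr.aemeasurable hOU.aemeasurable).1 hrOU,
      (indepFun_iff_map_prod_eq_prod_map_map hr.aemeasurable hU.1.aemeasurable).1 hrU,
      hU.2.2 O hO]
  rw [← integral_map (hr.prodMk hOU).aemeasurable hf.aestronglyMeasurable, hmap,
    integral_map (hr.prodMk hU.1).aemeasurable hf.aestronglyMeasurable]

lemma integrable_mulVec_sq (hU : IsHaarOrth P U) {x : Fin (L + 1) → ℝ}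
    (hx : ∑ k, x k ^ 2 = 1) (i : Fin (L + 1)) :
    Integrable (fun ω => (U ω *ᵥ x) i ^ 2) P := by
  refine .of_bound (((measurable_mulVec_apply x i).comp hU.1).pow_const 2).aestronglyMeasurable 1
    (.of_forall fun ω => ?_)
  rw [Real.norm_of_nonneg (sq_nonneg _), ← hx, ← sum_mulVec_sq_of_mem_orthogonalGroup (hU.2.1 ω) x]
  exact Finset.single_le_sum (f := fun k => (U ω *ᵥ x) k ^ 2) (fun k _ => sq_nonneg _)
    (Finset.mem_univ i)

lemma integral_mulVec_sq (hU : IsHaarOrth P U) {x : Fin (L + 1) → ℝ}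
    (hx : ∑ k, x k ^ 2 = 1) (i : Fin (L + 1)) :
    ∫ ω, (U ω *ᵥ x) i ^ 2 ∂P = 1 / (L + 1) := by
  have heq (j : Fin (L + 1)) : ∫ ω, (U ω *ᵥ x) j ^ 2 ∂P = ∫ ω, (U ω *ᵥ x) i ^ 2 ∂P := by
    have hO : (Equiv.swap i j).permMatrix ℝ ∈ orthogonalGroup (Fin (L + 1)) ℝ := by
      rw [mem_orthogonalGroup_iff, transpose_permMatrix, ← permMatrix_mul]
      simp
    rw [← hU.integral_comp_mul_left hO measurable_const (indepFun_const_left (0 : ℝ) U)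
      (f := fun p => (p.2 *ᵥ x) i ^ 2)
      (((measurable_mulVec_apply x i).comp measurable_snd).pow_const 2)]
    simp [← mulVec_mulVec, permMatrix_mulVec]
  have hsum : ∑ j, ∫ ω, (U ω *ᵥ x) j ^ 2 ∂P = 1 := by
    rw [← integral_finsetSum _ fun j _ => hU.integrable_mulVec_sq hx j]
    simp [sum_mulVec_sq_of_mem_orthogonalGroup (hU.2.1 _), hx]
  simp only [heq, Finset.sum_const, Finset.card_univ, Fintype.card_fin, nsmul_eq_mul] at hsum
  push_cast at hsum
  rw [eq_div_iff (by positivity), mul_comm, hsum]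

lemma integral_sum_mulVec_sq (hU : IsHaarOrth P U) {x : Fin (L + 1) → ℝ}
    (hx : ∑ k, x k ^ 2 = 1) (S : Finset (Fin (L + 1))) :
    ∫ ω, ∑ k ∈ S, (U ω *ᵥ x) k ^ 2 ∂P = S.card / (L + 1) := by
  rw [integral_finsetSum _ fun j _ => hU.integrable_mulVec_sq hx j]
  simp [hU.integral_mulVec_sq hx, div_eq_mul_inv]

lemma integral_sqRatio_mulVec_le (hU : IsHaarOrth P U) {x : Fin (L + 1) → ℝ}
    (hx : ∑ k, x k ^ 2 = 1) (S : Finset (Fin (L + 1))) {r : Ω → ℝ} (hr : Measurable r)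
    (hr01 : ∀ ω, r ω ∈ Set.Icc (0 : ℝ) 1) (hrU : IndepFun r U P) {l : ℝ} (hl : 0 ≤ l)
    (hl4 : l ≤ 1 / 4) :
    ∫ ω, sqRatio S x (l * r ω) (U ω *ᵥ x) ∂P
      ≤ ∑ k ∈ S, x k ^ 2 + l ^ 2 * 3 * (S.card / (L + 1)) := by
  set R : Matrix (Fin (L + 1)) (Fin (L + 1)) ℝ := (2 : ℝ) • vecMulVec x x - 1
  have hRO : R ∈ orthogonalGroup (Fin (L + 1)) ℝ :=
    two_smul_vecMulVec_sub_one_mem_orthogonalGroup hx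
  have hmeas := measurable_sqRatio_mulVec S x l
  have hRU : Measurable fun ω => R * U ω := (measurable_matrix_mul_left R).comp hU.1
  have hint {V : Ω → Matrix (Fin (L + 1)) (Fin (L + 1)) ℝ} (hV : Measurable V) :
      Integrable (fun ω => sqRatio S x (l * r ω) (V ω *ᵥ x)) P := by
    refine .of_bound (hmeas.comp (hr.prodMk hV)).aestronglyMeasurable 1 (.of_forall fun ω => ?_)
    rw [Real.norm_of_nonneg (sqRatio_nonneg ..)]
    exact sqRatio_le_one ..
  have hmem (ω : Ω) : R * U ω ∈ orthogonalGroup (Fin (L + 1)) ℝ := mul_mem hRO (hU.2.1 ω)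
  have hHaar : IsHaarOrth P fun ω => R * U ω := by
    refine ⟨hRU, hmem, fun O hO => ?_⟩
    simp only [← mul_assoc]
    rw [hU.2.2 _ (mul_mem hO hRO), hU.2.2 _ hRO]
  have hintS {V : Ω → Matrix (Fin (L + 1)) (Fin (L + 1)) ℝ} (hV : IsHaarOrth P V) :
      Integrable (fun ω => ∑ k ∈ S, (V ω *ᵥ x) k ^ 2) P :=
    integrable_finsetSum _ fun k _ => hV.integrable_mulVec_sq hx k
  have hadd : Integrable (fun ω =>
      ∑ k ∈ S, (U ω *ᵥ x) k ^ 2 + ∑ k ∈ S, ((R * U ω) *ᵥ x) k ^ 2) P :=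
    (hintS hU).add (hintS hHaar)
  have hle : ∫ ω, (sqRatio S x (l * r ω) (U ω *ᵥ x)
        + sqRatio S x (l * r ω) ((R * U ω) *ᵥ x)) ∂P
      ≤ ∫ ω, (2 * ∑ k ∈ S, x k ^ 2 + l ^ 2 * 3 *
        (∑ k ∈ S, (U ω *ᵥ x) k ^ 2 + ∑ k ∈ S, ((R * U ω) *ᵥ x) k ^ 2)) ∂P := by
    refine integral_mono ((hint hU.1).add (hint hRU))
      ((integrable_const _).add (hadd.const_mul _)) fun ω => ?_
    refine sqRatio_add_sqRatio_reflection_le S hx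
      ((sum_mulVec_sq_of_mem_orthogonalGroup (hU.2.1 ω) x).trans hx)
      ((sum_mulVec_sq_of_mem_orthogonalGroup (hmem ω) x).trans hx) (fun k => ?_)
      (mul_nonneg hl (hr01 ω).1) (mul_le_of_le_one_right hl (hr01 ω).2) hl4
    rw [← mulVec_mulVec, two_smul_vecMulVec_sub_one_mulVec]
  rw [integral_add (hint hU.1) (hint hRU), hU.integral_comp_mul_left hRO hr hrU hmeas,
    integral_add (integrable_const _) (hadd.const_mul _),
    integral_const_mul, integral_const_mul, integral_add (hintS hU) (hintS hHaar),
    hU.integral_sum_mulVec_sq hx,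
    hHaar.integral_sum_mulVec_sq hx] at hle
  simp only [integral_const, probReal_univ, one_smul] at hle
  linarith

end IsHaarOrth

theorem stmt13 {L : ℕ} (hL : 3 ≤ L) {Ω : Type*} [MeasurableSpace Ω]
    (P : Measure Ω) [IsProbabilityMeasure P]
    (lam : ℝ) (hlam : 0 < lam) (hlam4 : lam ≤ 1/4)
    (r : Ω → ℝ) (hr : Measurable r) (hr01 : ∀ ω, r ω ∈ Set.Icc (0:ℝ) 1)
    (U : Ω → Matrix (Fin (L+1)) (Fin (L+1)) ℝ) (hU : IsHaarOrth P U)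
    (hrU : IndepFun r U P)
    (La Lb Lc : ℕ) (hLa : 1 ≤ La) (hLb : 1 ≤ Lb) (hLc : 1 ≤ Lc)
    (hsum : La + Lb + Lc = L + 1) :
    ∀ v : Sph L,
      (∫ ω, naSq La ((actS (1 + (lam * r ω) • U ω) v : Sph L) :
          EuclideanSpace ℝ (Fin (L+1))) ∂P)
        ≤ naSq La (v : EuclideanSpace ℝ (Fin (L+1)))
            + lam^2 * (3 * (La:ℝ)) / ((L:ℝ)+1) := by
  intro v
  have hv : ∑ k, v.1 k ^ 2 = 1 := by
    rw [← EuclideanSpace.real_norm_sq_eq, mem_sphere_zero_iff_norm.1 v.2, one_pow]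
  set S := Finset.univ.filter fun k : Fin (L + 1) => (k : ℕ) < La with hS
  have hcard : S.card = La := by
    rw [hS, Fin.card_filter_val_lt, min_eq_right (by lia)]
  have hint : (fun ω => naSq La (actS (1 + (lam * r ω) • U ω) v : Sph L).1)
      = fun ω => sqRatio S v.1 (lam * r ω) (U ω *ᵥ v.1) := by
    funext ω
    have h := mul_le_of_le_one_right hlam.le (hr01 ω).2
    exact naSq_actS_one_add_smul La (hU.2.1 ω) (mul_nonneg hlam.le (hr01 ω).1) (by linarith) v hv
  have hmain := hU.integral_sqRatio_mulVec_le hv S hr hr01 hrU hlam.le hlam4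
  rw [hcard] at hmain
  rw [hint, naSq, ← Finset.sum_filter]
  exact hmain.trans_eq (by ring)
end
end

section
/- For all δ ∈ [0,1] one has ν_L({v ∈ 𝕊^L : ‖𝔠(v)‖² < δ}) = (Γ((L+1)/2)/(Γ(L_𝔠/2)·Γ((L_𝔞+L_𝔟)/2))) · ∫_0^δ x^{L_𝔠/2 − 1}(1−x)^{(L_𝔞+L_𝔟)/2 − 1} dx, i.e. under ν_L the quantity ‖𝔠(v)‖² is beta distributed with parameters ((L_𝔞+L_𝔟)/2, L_𝔠/2) — note the first parameter of the stated beta law corresponds to the exponent of (1−x). Moreover, if (L_𝔞, L_𝔟) ≠ (1,1), then ν_L({v ∈ 𝕊^L : ‖𝔠(v)‖² < δ}) ≤ ((L+1)/(L_𝔞+L_𝔟))^{(L_𝔞+L_𝔟)/2 − 1} · ((L+1)δ/L_𝔠)^{L_𝔠/2} · (1 − δ/6). -/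
open MeasureTheory ProbabilityTheory Matrix Real
open scoped ENNReal

noncomputable section

theorem charFun_eq_of_norm_eq {E : Type*} [NormedAddCommGroup E] [InnerProductSpace ℝ E]
    [MeasurableSpace E] [BorelSpace E] {μ : Measure E}
    (hμ : ∀ e : E ≃ₗᵢ[ℝ] E, μ.map e = μ) {s t : E} (h : ‖s‖ = ‖t‖) :
    charFun μ s = charFun μ t := by
  have he := Submodule.reflection_sub h
  set e := (ℝ ∙ (s - t))ᗮ.reflection
  conv_rhs => rw [← hμ e, charFun_apply, ← he]
  rw [integral_map e.continuous.aemeasurable (by fun_prop), charFun_apply]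
  simp

theorem eq_of_map_linearIsometryEquiv_eq {E : Type*} [NormedAddCommGroup E]
    [InnerProductSpace ℝ E] [FiniteDimensional ℝ E] [MeasurableSpace E] [BorelSpace E]
    {μ ν : Measure E} [IsProbabilityMeasure μ] [IsProbabilityMeasure ν]
    (hμ : ∀ e : E ≃ₗᵢ[ℝ] E, μ.map e = μ) (hν : ∀ e : E ≃ₗᵢ[ℝ] E, ν.map e = ν)
    (hμ₁ : ∀ᵐ x ∂μ, ‖x‖ = 1) (hν₁ : ∀ᵐ x ∂ν, ‖x‖ = 1) : μ = ν := by
  apply Measure.ext_of_charFun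
  ext t
  calc charFun μ t = ∫ w, charFun μ (‖t‖ • w) ∂ν := by
        rw [integral_congr_ae (g := fun _ => charFun μ t)]
        · simp
        · filter_upwards [hν₁] with w hw
          exact charFun_eq_of_norm_eq hμ (by simp [norm_smul, hw])
    _ = ∫ v, charFun ν (‖t‖ • v) ∂μ := by
        simp only [charFun_apply]
        rw [integral_integral_swap]
        · simp only [real_inner_smul_right, real_inner_comm]
        · refine Integrable.of_bound (C := 1) ?_ ?_
          · refine Continuous.aestronglyMeasurable ?_
            fun_prop
          · refine .of_forall fun x => ?_
            simp only [Function.uncurry, Complex.norm_exp_ofReal_mul_I, le_refl]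
    _ = charFun ν t := by
        rw [integral_congr_ae (g := fun _ => charFun ν t)]
        · simp
        · filter_upwards [hμ₁] with w hw
          exact charFun_eq_of_norm_eq hν (by simp [norm_smul, hw])

theorem lintegral_comp_const_mul {w : ℝ} (hw : w ≠ 0) {h : ℝ → ℝ≥0∞} (hh : Measurable h) :
    ∫⁻ v, h v = ∫⁻ x, ENNReal.ofReal |w| * h (w * x) := by
  rw [lintegral_const_mul _ (by fun_prop), ← lintegral_map (g := fun x => w * x) hh (by fun_prop),
    Real.map_volume_mul_left hw, lintegral_smul_measure, smul_eq_mul, ← mul_assoc,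
    ← ENNReal.ofReal_mul (abs_nonneg _), ← abs_mul, mul_inv_cancel₀ hw]
  simp

theorem gammaPDF_mul_gammaPDF {p q r w x : ℝ} (hp : 0 < p) (hq : 0 < q) (hr : 0 < r)
    (hw : w ≠ 0) (hx₀ : x ≠ 0) (hx₁ : x ≠ 1) :
    ENNReal.ofReal |w| * (gammaPDF q r (w * x) * gammaPDF p r (w - w * x)) =
      gammaPDF (p + q) r w * betaPDF q p x := by
  rcases hw.lt_or_gt with hw | hw
  · rw [gammaPDF_of_neg hw]
    rcases hx₀.lt_or_gt with hx | hx
    · rw [gammaPDF_of_neg (show w - w * x < 0 by nlinarith)]; simp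
    · rw [gammaPDF_of_neg (show w * x < 0 by nlinarith)]; simp
  rcases hx₀.lt_or_gt with hx | hx
  · rw [gammaPDF_of_neg (show w * x < 0 by nlinarith), betaPDF_eq_zero_of_nonpos hx.le]; simp
  rcases hx₁.lt_or_gt with hx' | hx'
  · have hx'' : 0 < 1 - x := by linarith
    rw [gammaPDF_of_nonneg (by positivity), gammaPDF_of_nonneg (by nlinarith),
      gammaPDF_of_nonneg hw.le, betaPDF_of_pos_lt_one hx hx',
      ← ENNReal.ofReal_mul, ← ENNReal.ofReal_mul, ← ENNReal.ofReal_mul, abs_of_pos hw]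
    · congr 1
      have e : w - w * x = w * (1 - x) := by ring
      have h1 := Real.Gamma_pos_of_pos hp
      have h2 := Real.Gamma_pos_of_pos hq
      have h3 := Real.Gamma_pos_of_pos (add_pos hp hq)
      have h4 : w ^ (p + q - 1) = w ^ (p - 1) * w ^ (q - 1) * w := by
        rw [← rpow_add hw, ← rpow_add_one hw.ne']; ring_nf
      have h5 : rexp (-(r * w)) = rexp (-(r * (w * x))) * rexp (-(r * (w * (1 - x)))) := by
        rw [← Real.exp_add]; ring_nf
      rw [e, mul_rpow hw.le hx.le, mul_rpow hw.le hx''.le, beta, add_comm q p, h4, h5,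
        rpow_add hr]
      field_simp
    all_goals positivity
  · rw [gammaPDF_of_neg (show w - w * x < 0 by nlinarith), betaPDF_eq_zero_of_one_le hx'.le]; simp

theorem lintegral_gammaMeasure_gammaMeasure {p q r : ℝ} (hp : 0 < p) (hq : 0 < q) (hr : 0 < r)
    {f : ℝ → ℝ → ℝ≥0∞} (hf : Measurable (Function.uncurry f)) :
    ∫⁻ v, ∫⁻ u, f (u + v) v ∂gammaMeasure p r ∂gammaMeasure q r =
      ∫⁻ w, ∫⁻ x, f w (w * x) ∂betaMeasure q p ∂gammaMeasure (p + q) r := by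
  have mg (a : ℝ) : Measurable (gammaPDF a r) := by unfold gammaPDF; fun_prop
  have mb : Measurable (betaPDF q p) := by unfold betaPDF; fun_prop
  have hf' {α : Type} [MeasurableSpace α] {a b : α → ℝ} (ha : Measurable a) (hb : Measurable b) :
      Measurable fun z => f (a z) (b z) := hf.comp (ha.prodMk hb)
  have m₁ (v : ℝ) : Measurable fun u => f (u + v) v := hf' (by fun_prop) (by fun_prop)
  have m₂ (w : ℝ) : Measurable fun x => f w (w * x) := hf' (by fun_prop) (by fun_prop)
  have m₃ (w : ℝ) : Measurable fun x => f w x := hf' (by fun_prop) (by fun_prop)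
  have n₁ : Measurable fun v => ∫⁻ u, gammaPDF p r u * f (u + v) v := by
    refine Measurable.lintegral_prod_right' (f := fun z : ℝ × ℝ => gammaPDF p r z.2 * f (z.2 + z.1) z.1) ?_
    exact ((mg p).comp measurable_snd).mul (hf' (by fun_prop) (by fun_prop))
  have n₂ : Measurable fun w => ∫⁻ x, betaPDF q p x * f w (w * x) := by
    refine Measurable.lintegral_prod_right' (f := fun z : ℝ × ℝ => betaPDF q p z.2 * f z.1 (z.1 * z.2)) ?_
    exact (mb.comp measurable_snd).mul (hf' (by fun_prop) (by fun_prop))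
  simp only [gammaMeasure, betaMeasure]
  simp_rw [lintegral_withDensity_eq_lintegral_mul _ (mg p) (m₁ _),
    lintegral_withDensity_eq_lintegral_mul _ mb (m₂ _), Pi.mul_apply]
  rw [lintegral_withDensity_eq_lintegral_mul _ (mg q) n₁,
    lintegral_withDensity_eq_lintegral_mul _ (mg _) n₂]
  simp only [Pi.mul_apply]
  calc ∫⁻ v, gammaPDF q r v * ∫⁻ u, gammaPDF p r u * f (u + v) v
      = ∫⁻ v, ∫⁻ w, gammaPDF q r v * gammaPDF p r (w - v) * f w v := by
        refine lintegral_congr fun v => ?_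
        have m : Measurable fun u => gammaPDF p r u * f (u + v) v := (mg p).mul (m₁ v)
        rw [← lintegral_const_mul _ m,
          ← lintegral_sub_right_eq_self _ v]
        simp only [sub_add_cancel, mul_assoc]
    _ = ∫⁻ w, ∫⁻ v, gammaPDF q r v * gammaPDF p r (w - v) * f w v := by
        refine lintegral_lintegral_swap (Measurable.aemeasurable ?_)
        exact (((mg q).comp measurable_fst).mul ((mg p).comp (measurable_snd.sub measurable_fst))).mul
          (hf' (by fun_prop) (by fun_prop))
    _ = ∫⁻ w, gammaPDF (p + q) r w * ∫⁻ x, betaPDF q p x * f w (w * x) := by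
        refine lintegral_congr_ae ?_
        filter_upwards [Measure.ae_ne volume 0] with w hw
        have m : Measurable fun v => gammaPDF q r v * gammaPDF p r (w - v) * f w v :=
          ((mg q).mul ((mg p).comp (by fun_prop))).mul (m₃ w)
        have m' : Measurable fun x => betaPDF q p x * f w (w * x) := mb.mul (m₂ w)
        rw [lintegral_comp_const_mul hw m, ← lintegral_const_mul _ m']
        refine lintegral_congr_ae ?_
        filter_upwards [Measure.ae_ne volume 0, Measure.ae_ne volume 1] with x hx₀ hx₁
        rw [← mul_assoc, gammaPDF_mul_gammaPDF hp hq hr hw hx₀ hx₁, mul_assoc]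

theorem gammaMeasure_conv_gammaMeasure {p q r : ℝ} (hp : 0 < p) (hq : 0 < q) (hr : 0 < r) :
    (gammaMeasure p r) ∗ (gammaMeasure q r) = gammaMeasure (p + q) r := by
  have := isProbabilityMeasure_gammaMeasure hp hr
  have := isProbabilityMeasure_gammaMeasure hq hr
  have := isProbabilityMeasureBeta hq hp
  ext s hs
  have h := lintegral_gammaMeasure_gammaMeasure hp hq hr
    (f := fun w _ => s.indicator 1 w) ((measurable_one.indicator hs).comp measurable_fst)
  simp only [lintegral_const, measure_univ, mul_one, lintegral_indicator_one hs] at h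
  rw [Measure.conv_comm, ← h, ← lintegral_indicator_one hs, Measure.lintegral_conv (measurable_one.indicator hs)]
  simp only [add_comm]

theorem map_sq_gaussianReal :
    (gaussianReal 0 1).map (fun x => x ^ 2) = gammaMeasure (1 / 2) (1 / 2) := by
  have key {A : Set ℝ} (hA : MeasurableSet A) (hA' : ∀ x ∈ A, x ≠ 0)
      (hinj : Set.InjOn (fun x : ℝ => x ^ 2) A) (him : (fun x : ℝ => x ^ 2) '' A = Set.Ioi 0)
      {s : Set ℝ} :
      ∫⁻ x in Set.Ioi 0, gammaPDF (1 / 2) (1 / 2) x * s.indicator 1 x =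
        2 * ∫⁻ x in A, gaussianPDF 0 1 x * s.indicator 1 (x ^ 2) := by
    rw [← him, lintegral_image_eq_lintegral_abs_deriv_mul (f' := fun x => 2 * x) hA
      (fun x _ => by simpa using (hasDerivAt_pow 2 x).hasDerivWithinAt) hinj,
      ← lintegral_const_mul' _ _ (by simp)]
    refine setLIntegral_congr_fun hA fun x hx => ?_
    rw [← mul_assoc, ← mul_assoc, gammaPDF_of_nonneg (sq_nonneg x), gaussianPDF, gaussianPDFReal,
      ← ENNReal.ofReal_mul (abs_nonneg _), ← ENNReal.ofReal_ofNat 2, ← ENNReal.ofReal_mul (by simp)]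
    congr 2
    have hx' : 0 < |x| := abs_pos.2 (hA' x hx)
    have e : (x ^ 2) ^ ((1 : ℝ) / 2 - 1) = |x|⁻¹ := by
      rw [← sq_abs, ← rpow_natCast, ← rpow_mul hx'.le, ← rpow_neg_one]
      norm_num
    rw [e, Real.Gamma_one_half_eq, abs_mul, abs_two, ← sqrt_eq_rpow, sqrt_div zero_le_one]
    simp
    field_simp
  have neg_part : (fun x : ℝ => x ^ 2) '' Set.Iio 0 = Set.Ioi 0 := by
    ext y
    refine ⟨?_, fun hy => ⟨-√y, by simpa using hy, by simp [sq_sqrt (le_of_lt hy)]⟩⟩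
    rintro ⟨x, hx, rfl⟩
    exact sq_pos_of_neg (Set.mem_Iio.1 hx)
  have pos_part : (fun x : ℝ => x ^ 2) '' Set.Ioi 0 = Set.Ioi 0 := by
    ext y
    refine ⟨?_, fun hy => ⟨√y, by simpa using hy, sq_sqrt (le_of_lt hy)⟩⟩
    rintro ⟨x, hx, rfl⟩
    exact pow_pos (Set.mem_Ioi.1 hx) 2
  have split (h : ℝ → ℝ≥0∞) : ∫⁻ x, h x = (∫⁻ x in Set.Iio 0, h x) + ∫⁻ x in Set.Ioi 0, h x := by
    rw [← lintegral_add_compl h measurableSet_Iio, Set.compl_Iio,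
      setLIntegral_congr Ioi_ae_eq_Ici.symm]
  ext s hs
  have hm : Measurable (s.indicator (1 : ℝ → ℝ≥0∞)) := measurable_one.indicator hs
  have mg : Measurable (gammaPDF (1 / 2) (1 / 2)) := by unfold gammaPDF; fun_prop
  rw [← lintegral_indicator_one hs, ← lintegral_indicator_one hs, lintegral_map hm (by fun_prop),
    gammaMeasure, lintegral_withDensity_eq_lintegral_mul _ mg hm,
    gaussianReal_of_var_ne_zero _ one_ne_zero,
    lintegral_withDensity_eq_lintegral_mul _ (by fun_prop) (by fun_prop)]
  simp only [Pi.mul_apply]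
  have h₀ : ∫⁻ x in Set.Iio 0, gammaPDF (1 / 2) (1 / 2) x * s.indicator 1 x = 0 :=
    setLIntegral_eq_zero measurableSet_Iio fun x hx => by
      rw [gammaPDF_of_neg hx, zero_mul, Pi.zero_apply]
  rw [split, split (fun x => gammaPDF _ _ x * _), h₀, zero_add]
  have h₁ := key measurableSet_Iio (fun x hx => hx.ne) (fun x hx y hy h => by
    rcases sq_eq_sq_iff_eq_or_eq_neg.1 h with h | h
    · exact h
    · linarith [Set.mem_Iio.1 hx, Set.mem_Iio.1 hy]) neg_part (s := s)
  have h₂ := key measurableSet_Ioi (fun x hx => hx.ne') (fun x hx y hy h =>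
    (pow_left_inj₀ (le_of_lt (Set.mem_Ioi.1 hx)) (le_of_lt (Set.mem_Ioi.1 hy)) two_ne_zero).1 h) pos_part (s := s)
  have h₃ : (2 : ℝ≥0∞) ≠ 0 := two_ne_zero
  rw [← ENNReal.mul_right_inj h₃ (by simp), mul_add, ← h₁, ← h₂, two_mul]

theorem map_sum_sq_pi_gaussianReal {ι : Type*} [Fintype ι] {s : Finset ι} (hs : s.Nonempty) :
    (Measure.pi fun _ : ι => gaussianReal 0 1).map (fun x => ∑ k ∈ s, x k ^ 2) =
      gammaMeasure (s.card / 2) (1 / 2) := by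
  have hind : iIndepFun (fun (k : ι) (x : ι → ℝ) => x k ^ 2)
      (Measure.pi fun _ : ι => gaussianReal 0 1) :=
    iIndepFun_pi (X := fun _ x => x ^ 2) fun _ => by fun_prop
  have hone (k : ι) : (Measure.pi fun _ : ι => gaussianReal 0 1).map (fun x => x k ^ 2) =
      gammaMeasure (1 / 2) (1 / 2) := by
    have h := (measurePreserving_eval (fun _ : ι => gaussianReal 0 1) k).map_eq
    calc _ = ((Measure.pi fun _ : ι => gaussianReal 0 1).map (Function.eval k)).map
          (fun x => x ^ 2) := by rw [Measure.map_map (by fun_prop) (by fun_prop)]; rfl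
      _ = _ := by rw [h, map_sq_gaussianReal]
  induction hs using Finset.Nonempty.cons_induction with
  | singleton a => simpa using hone a
  | cons a s ha hs ih =>
    have h := hind.indepFun_finsetSum_of_notMem (fun k => by fun_prop) ha
    have e : (fun x : ι → ℝ => ∑ k ∈ Finset.cons a s ha, x k ^ 2) =
        (∑ k ∈ s, fun x : ι → ℝ => x k ^ 2) + fun x => x a ^ 2 := by
      ext x
      simp [add_comm]
    have e' : (∑ k ∈ s, fun x : ι → ℝ => x k ^ 2) = fun x => ∑ k ∈ s, x k ^ 2 := by
      ext x
      simp
    have hs' : 0 < (s.card : ℝ) := by exact_mod_cast hs.card_pos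
    rw [e, h.map_add_eq_map_conv_map (by rw [e']; fun_prop) (by fun_prop), e', ih, hone,
      gammaMeasure_conv_gammaMeasure (by positivity) (by norm_num) (by norm_num),
      Finset.card_cons]
    congr 1
    push_cast
    ring

theorem pi_gaussianReal_sum_sq_lt {ι : Type*} [Fintype ι] [DecidableEq ι] {s : Finset ι}
    (hs : s.Nonempty) (hs' : sᶜ.Nonempty) (δ : ℝ) :
    (Measure.pi fun _ : ι => gaussianReal 0 1) {x | ∑ k ∈ s, x k ^ 2 < δ * ∑ k, x k ^ 2} =
      betaMeasure (s.card / 2) (sᶜ.card / 2) (Set.Iio δ) := by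
  set μ := Measure.pi fun _ : ι => gaussianReal 0 1
  have hq : (0 : ℝ) < s.card / 2 := by have := hs.card_pos; positivity
  have hp : (0 : ℝ) < sᶜ.card / 2 := by have := hs'.card_pos; positivity
  have hr : (0 : ℝ) < 1 / 2 := by norm_num
  have := isProbabilityMeasure_gammaMeasure hp hr
  have := isProbabilityMeasure_gammaMeasure hq hr
  have := isProbabilityMeasure_gammaMeasure (add_pos hp hq) hr
  have := isProbabilityMeasureBeta hq hp
  have hind : iIndepFun (fun (k : ι) (x : ι → ℝ) => x k) μ :=
    iIndepFun_pi (X := fun _ x => x) fun _ => by fun_prop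
  have hind' : IndepFun (fun x : ι → ℝ => ∑ k ∈ s, x k ^ 2)
      (fun x : ι → ℝ => ∑ k ∈ sᶜ, x k ^ 2) μ := by
    have h := (hind.indepFun_finset s sᶜ disjoint_compl_right (fun k => by fun_prop)).comp
      (φ := fun y : s → ℝ => ∑ k, y k ^ 2) (ψ := fun y : ↥sᶜ → ℝ => ∑ k, y k ^ 2)
      (by fun_prop) (by fun_prop)
    convert h using 1
    · ext x; exact (Finset.sum_coe_sort s fun k => x k ^ 2).symm
    · ext x; exact (Finset.sum_coe_sort sᶜ fun k => x k ^ 2).symm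
  have hjoint := (indepFun_iff_map_prod_eq_prod_map_map (Measurable.aemeasurable (by fun_prop))
    (Measurable.aemeasurable (by fun_prop))).1 hind'
  rw [map_sum_sq_pi_gaussianReal hs, map_sum_sq_pi_gaussianReal hs'] at hjoint
  have hA : MeasurableSet {z : ℝ × ℝ | z.2 < δ * z.1} :=
    measurableSet_lt (by fun_prop) (by fun_prop)
  have hB : MeasurableSet {z : ℝ × ℝ | z.1 < δ * (z.2 + z.1)} :=
    measurableSet_lt (by fun_prop) (by fun_prop)
  have hpre : {x : ι → ℝ | ∑ k ∈ s, x k ^ 2 < δ * ∑ k, x k ^ 2} =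
      (fun x : ι → ℝ => (∑ k ∈ s, x k ^ 2, ∑ k ∈ sᶜ, x k ^ 2)) ⁻¹'
        {z : ℝ × ℝ | z.1 < δ * (z.2 + z.1)} := by
    ext x
    simp [← Finset.sum_compl_add_sum s]
  have key := lintegral_gammaMeasure_gammaMeasure hp hq hr
    (f := fun w v => {z : ℝ × ℝ | z.2 < δ * z.1}.indicator 1 (w, v))
    (measurable_one.indicator hA)
  rw [hpre, ← Measure.map_apply (by fun_prop) hB, hjoint, ← lintegral_indicator_one hB,
    lintegral_prod _ (measurable_one.indicator hB).aemeasurable]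
  refine key.trans ?_
  have hpos : ∀ᵐ w ∂gammaMeasure (sᶜ.card / 2 + s.card / 2) (1 / 2), 0 < w := by
    rw [gammaMeasure, ae_withDensity_iff (by unfold gammaPDF; fun_prop)]
    filter_upwards [Measure.ae_ne volume 0] with w hw hw'
    contrapose! hw'
    exact gammaPDF_of_neg (lt_of_le_of_ne hw' hw)
  rw [lintegral_congr_ae (g := fun _ => betaMeasure (s.card / 2) (sᶜ.card / 2) (Set.Iio δ))]
  · rw [lintegral_const, measure_univ, mul_one]
  · filter_upwards [hpos] with w hw
    rw [← lintegral_indicator_one measurableSet_Iio]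
    refine lintegral_congr fun x => ?_
    simp only [Set.indicator_apply, Set.mem_ofPred_eq, Set.mem_Iio, mul_comm δ, mul_lt_mul_iff_right₀ hw]
    rfl

theorem ae_ne_zero_stdGaussian {ι : Type*} [Fintype ι] [Nonempty ι] :
    ∀ᵐ x ∂stdGaussian (EuclideanSpace ℝ ι), x ≠ 0 := by
  have : NullSingletonClass (gaussianReal 0 1) := nullSingletonClass_gaussianReal one_ne_zero
  have h0 : MeasurableSet {x : EuclideanSpace ℝ ι | x ≠ 0} := (measurableSet_singleton 0).compl
  rw [← map_pi_eq_stdGaussian, ae_map_iff (by fun_prop) h0]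
  filter_upwards [Measure.ae_ne (Measure.pi fun _ : ι => gaussianReal 0 1) 0] with x hx
  simpa using hx

theorem map_coe_eq_map_normalize_stdGaussian {L : ℕ} {ν : Measure (Sph L)}
    (hν : IsUniformSphere ν) :
    ν.map (Subtype.val : Sph L → EuclideanSpace ℝ (Fin (L + 1))) =
      (stdGaussian (EuclideanSpace ℝ (Fin (L + 1)))).map fun x => ‖x‖⁻¹ • x := by
  obtain ⟨_, hinv⟩ := hν
  have hn : Measurable fun x : EuclideanSpace ℝ (Fin (L + 1)) => ‖x‖⁻¹ • x := by fun_prop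
  have := Measure.isProbabilityMeasure_map (μ := ν)
    (measurable_subtype_coe (p := (· ∈ Sph L))).aemeasurable
  have := Measure.isProbabilityMeasure_map
    (μ := stdGaussian (EuclideanSpace ℝ (Fin (L + 1)))) hn.aemeasurable
  have hnorm : MeasurableSet {x : EuclideanSpace ℝ (Fin (L + 1)) | ‖x‖ = 1} :=
    measurableSet_eq_fun (by fun_prop) (by fun_prop)
  apply eq_of_map_linearIsometryEquiv_eq
  · intro e
    let b := EuclideanSpace.basisFun (Fin (L + 1)) ℝ
    let O := LinearMap.toMatrix b.toBasis b.toBasis (e.toLinearEquiv : _ →ₗ[ℝ] _)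
    have hO : O ∈ Matrix.orthogonalGroup (Fin (L + 1)) ℝ := e.toMatrix_mem_unitaryGroup b b
    have hOe (v : EuclideanSpace ℝ (Fin (L + 1))) : Matrix.toEuclideanLin O v = e v := by
      rw [Matrix.toEuclideanLin_eq_toLin_orthonormal]
      simp [O, b]
    have hact : (Subtype.val : Sph L → EuclideanSpace ℝ (Fin (L + 1))) ∘ actS O =
        e ∘ Subtype.val := by
      ext1 v
      simp [actS, act, hOe]
    have hactm : Measurable (actS O : Sph L → Sph L) := by
      have : (actS O : Sph L → Sph L) = fun v => ⟨e v, by simp⟩ :=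
        funext fun v => Subtype.ext (congrFun hact v)
      rw [this]
      exact Measurable.subtype_mk (by fun_prop)
    conv_rhs => rw [← hinv O hO]
    rw [Measure.map_map (by fun_prop) hactm, hact,
      Measure.map_map (by fun_prop) (by fun_prop)]
  · intro e
    conv_rhs => rw [← stdGaussian_map e]
    rw [Measure.map_map (by fun_prop) hn, Measure.map_map hn (by fun_prop)]
    congr 1
    ext1 x
    simp
  · rw [ae_map_iff (by fun_prop) hnorm]
    exact .of_forall fun v => by simp
  · rw [ae_map_iff (by fun_prop) hnorm]
    filter_upwards [ae_ne_zero_stdGaussian] with x hx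
    simp [norm_smul, hx]

theorem IsUniformSphere.ncSq_lt {L : ℕ} {ν : Measure (Sph L)} (hν : IsUniformSphere ν)
    {m : ℕ} (hm : 0 < m) (hmL : m < L + 1) (δ : ℝ) :
    ν {v : Sph L | ncSq m (v : EuclideanSpace ℝ (Fin (L + 1))) < δ} =
      betaMeasure (((L + 1 - m : ℕ) : ℝ) / 2) ((m : ℝ) / 2) (Set.Iio δ) := by
  let s : Finset (Fin (L + 1)) := {k | m ≤ (k : ℕ)}
  have hsc : sᶜ.card = m := by
    have : sᶜ = ({k | (k : ℕ) < m} : Finset (Fin (L + 1))) := by ext; simp [s]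
    rw [this, Fin.card_filter_val_lt]
    omega
  have hs : s.card = L + 1 - m := by
    have := s.card_add_card_compl
    rw [Fintype.card_fin] at this
    omega
  have hsq (x : EuclideanSpace ℝ (Fin (L + 1))) : ncSq m x = ∑ k ∈ s, x k ^ 2 := by
    simp [ncSq, s, Finset.sum_filter]
  have hmeas : MeasurableSet {v : EuclideanSpace ℝ (Fin (L + 1)) | ncSq m v < δ} := by
    simp only [hsq]
    exact measurableSet_lt (by fun_prop) (by fun_prop)
  have hn : Measurable fun x : EuclideanSpace ℝ (Fin (L + 1)) => ‖x‖⁻¹ • x := by fun_prop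
  have h₁ : ν {v : Sph L | ncSq m (v : EuclideanSpace ℝ (Fin (L + 1))) < δ} =
      ν.map (Subtype.val : Sph L → EuclideanSpace ℝ (Fin (L + 1))) {v | ncSq m v < δ} := by
    rw [Measure.map_apply (by fun_prop) hmeas]
    rfl
  have h₂ : (fun x : EuclideanSpace ℝ (Fin (L + 1)) => ‖x‖⁻¹ • x) ⁻¹' {v | ncSq m v < δ} =ᵐ[
      stdGaussian (EuclideanSpace ℝ (Fin (L + 1)))]
      {x | ∑ k ∈ s, x k ^ 2 < δ * ∑ k, x k ^ 2} := by
    filter_upwards [ae_ne_zero_stdGaussian] with x hx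
    have hx' : 0 < ‖x‖ ^ 2 := by positivity
    refine propext ?_
    change ncSq m (‖x‖⁻¹ • x) < δ ↔ ∑ k ∈ s, x k ^ 2 < δ * ∑ k, x k ^ 2
    rw [hsq, ← EuclideanSpace.real_norm_sq_eq, ← div_lt_iff₀ hx']
    simp [mul_pow, ← Finset.mul_sum, div_eq_inv_mul]
  rw [h₁, map_coe_eq_map_normalize_stdGaussian hν, Measure.map_apply hn hmeas, measure_congr h₂,
    ← map_pi_eq_stdGaussian, Measure.map_apply (by fun_prop)
      (measurableSet_lt (by fun_prop) (by fun_prop)), ← hs]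
  conv_rhs => rw [← hsc]
  rw [← pi_gaussianReal_sum_sq_lt (Finset.card_pos.1 (by omega)) (Finset.card_pos.1 (by omega))]
  rfl

theorem betaMeasure_Iio_toReal {q p δ : ℝ} (hq : 0 < q) (hp : 0 < p) (hδ : δ ∈ Set.Icc (0 : ℝ) 1) :
    (betaMeasure q p (Set.Iio δ)).toReal =
      Real.Gamma (q + p) / (Real.Gamma q * Real.Gamma p) *
        ∫ x in (0 : ℝ)..δ, x ^ (q - 1) * (1 - x) ^ (p - 1) := by
  have hnn (x : ℝ) : 0 ≤ betaPDFReal q p x := by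
    by_cases h : 0 < x ∧ x < 1
    · exact (betaPDFReal_pos h.1 h.2 hq hp).le
    · simp [betaPDFReal, h]
  rw [betaMeasure, withDensity_apply _ measurableSet_Iio]
  simp only [betaPDF]
  rw [← integral_eq_lintegral_of_nonneg_ae (.of_forall hnn)
      (measurable_betaPDFReal q p).aestronglyMeasurable,
    setIntegral_eq_of_subset_of_forall_sdiff_eq_zero measurableSet_Iio
      (s := Set.Ioo 0 δ) (fun x hx => hx.2), intervalIntegral.integral_of_le hδ.1,
    integral_Ioc_eq_integral_Ioo, ← integral_const_mul]
  · refine setIntegral_congr_fun measurableSet_Ioo fun x hx => ?_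
    simp only [betaPDFReal, if_pos (⟨hx.1, hx.2.trans_le hδ.2⟩ : 0 < x ∧ x < 1), beta,
      one_div_div, mul_assoc]
  · rintro x ⟨hx, hx'⟩
    have : ¬ (0 < x ∧ x < 1) := fun h => hx' ⟨h.1, hx⟩
    simp [betaPDFReal, this]

theorem integral_rpow_mul_one_sub_rpow_le {q p δ : ℝ} (hq : 1 / 2 ≤ q) (hp : 3 / 2 ≤ p)
    (hδ : δ ∈ Set.Icc (0 : ℝ) 1) :
    ∫ x in (0 : ℝ)..δ, x ^ (q - 1) * (1 - x) ^ (p - 1) ≤ δ ^ q / q * (1 - δ / 6) := by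
  have hq₀ : 0 < q := by linarith
  have i₁ : IntervalIntegrable (fun x : ℝ => x ^ (q - 1)) volume 0 δ :=
    intervalIntegral.intervalIntegrable_rpow' (by linarith)
  have i₂ : IntervalIntegrable (fun x : ℝ => x ^ q) volume 0 δ :=
    intervalIntegral.intervalIntegrable_rpow' (by linarith)
  calc ∫ x in (0 : ℝ)..δ, x ^ (q - 1) * (1 - x) ^ (p - 1)
      ≤ ∫ x in (0 : ℝ)..δ, (x ^ (q - 1) - x ^ q * (1 / 2)) := by
        refine intervalIntegral.integral_mono_on_of_le_Ioo hδ.1 (i₁.mul_continuousOn ?_)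
          (i₁.sub (i₂.mul_const _)) fun x hx => ?_
        · exact (continuous_const.sub continuous_id).continuousOn.rpow_const
            fun _ _ => .inr (by linarith)
        · have hx₁ : 0 ≤ 1 - x := by linarith [hx.2, hδ.2]
          have h₁ : (1 - x) ^ (p - 1) ≤ (1 - x) ^ (1 / 2 : ℝ) := by
            rcases hx₁.eq_or_lt with h | h
            · rw [← h, zero_rpow (by linarith), zero_rpow (by norm_num)]
            · exact rpow_le_rpow_of_exponent_ge h (by linarith [hx.1]) (by linarith)
          have h₂ : (1 + -x) ^ (1 / 2 : ℝ) ≤ 1 + 1 / 2 * -x :=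
            rpow_one_add_le_one_add_mul_self (by linarith) (by norm_num) (by norm_num)
          rw [← sub_eq_add_neg] at h₂
          have e : x ^ q = x ^ (q - 1) * x := by
            rw [← rpow_add_one hx.1.ne']; simp
          have := mul_le_mul_of_nonneg_left (h₁.trans h₂) (rpow_nonneg hx.1.le (q - 1))
          rw [e]
          linarith
    _ = δ ^ q / q - δ ^ (q + 1) / (q + 1) * (1 / 2) := by
        rw [intervalIntegral.integral_sub i₁ (i₂.mul_const _),
          intervalIntegral.integral_mul_const, integral_rpow (.inl (by linarith)),
          integral_rpow (.inl (by linarith)), sub_add_cancel, zero_rpow hq₀.ne',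
          zero_rpow (by linarith), sub_zero, sub_zero]
    _ ≤ δ ^ q / q * (1 - δ / 6) := by
        rw [rpow_add_one' hδ.1 (by linarith)]
        have h : 1 / (q * 6) ≤ 1 / (q + 1) * (1 / 2) := by
          rw [div_mul_div_comm, div_le_div_iff₀ (by positivity) (by positivity)]
          linarith
        have h' := mul_le_mul_of_nonneg_left h (mul_nonneg (rpow_nonneg hδ.1 q) hδ.1)
        have e : δ ^ q / q * (1 - δ / 6) = δ ^ q / q - δ ^ q * δ * (1 / (q * 6)) := by
          field_simp
        rw [e]
        have e' : δ ^ q * δ / (q + 1) * (1 / 2) = δ ^ q * δ * (1 / (q + 1) * (1 / 2)) := by ring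
        rw [e']
        linarith

theorem div_add_one_rpow_le {x y : ℝ} (hx : 0 ≤ x) (hxy : x ≤ y) :
    (y / (y + 1)) ^ y ≤ (x / (x + 1)) ^ x := by
  rcases hx.eq_or_lt with rfl | hx
  · rw [rpow_zero]
    exact rpow_le_one (by positivity) (div_le_one_of_le₀ (by linarith) (by linarith)) hxy
  have hy : 0 < y := hx.trans_le hxy
  have h := one_add_mul_self_le_rpow_one_add (s := 1 / y) (p := y / x)
    (by have : 0 < 1 / y := by positivity
        linarith) ((one_le_div hx).2 hxy)
  have e : 1 + y / x * (1 / y) = (x / (x + 1))⁻¹ := by field_simp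
  have e' : 1 + 1 / y = (y / (y + 1))⁻¹ := by field_simp
  have h' := rpow_le_rpow (by positivity) h hx.le
  rw [← rpow_mul (by positivity), div_mul_cancel₀ _ hx.ne', e, e', inv_rpow (by positivity),
    inv_rpow (by positivity)] at h'
  exact (inv_le_inv₀ (by positivity) (by positivity)).1 h'

theorem Gamma_add_one_div_rpow_half_add_le (m n : ℕ) :
    Real.Gamma ((m + n : ℕ) / 2 + 1) / ((m + n : ℕ) / 2 : ℝ) ^ ((m + n : ℕ) / 2 : ℝ) ≤
      Real.Gamma (m / 2 + 1) / (m / 2 : ℝ) ^ (m / 2 : ℝ) *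
        (Real.Gamma (n / 2 + 1) / (n / 2 : ℝ) ^ (n / 2 : ℝ)) := by
  let G (k : ℕ) : ℝ := Real.Gamma (k / 2 + 1) / (k / 2 : ℝ) ^ (k / 2 : ℝ)
  let R (k : ℕ) : ℝ := (k / 2 / (k / 2 + 1) : ℝ) ^ (k / 2 : ℝ)
  have hG (k : ℕ) : 0 < G k := by
    have h : 0 < Real.Gamma (k / 2 + 1) := Real.Gamma_pos_of_pos (by positivity)
    rcases k.eq_zero_or_pos with rfl | hk
    · simp [G]
    · positivity
  have hR (k : ℕ) : 0 ≤ R k := by positivity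
  have hR' {k l : ℕ} (h : k ≤ l) : R l ≤ R k :=
    div_add_one_rpow_le (by positivity) (by gcongr)
  have hstep (k : ℕ) : G (k + 2) = G k * R k := by
    have e : ((k + 2 : ℕ) / 2 : ℝ) = k / 2 + 1 := by push_cast; ring
    simp only [G, R, e]
    rcases k.eq_zero_or_pos with rfl | hk
    · simp [one_add_one_eq_two]
    · have hx : 0 < (k / 2 : ℝ) := by positivity
      generalize (k / 2 : ℝ) = x at hx ⊢
      rw [Real.Gamma_add_one (s := x + 1) (by positivity), div_rpow hx.le (by positivity),
        rpow_add_one (by positivity)]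
      field_simp
  have hG0 : G 0 = 1 := by simp [G]
  have hG2 : G 2 = 1 := by simp [G, one_add_one_eq_two]
  have hG1 : 1 ≤ G 1 * G 1 := by
    have e : G 1 = √π / 2 / √(1 / 2) := by
      simp only [G, Nat.cast_one]
      rw [Real.Gamma_add_one (by norm_num), Real.Gamma_one_half_eq, ← sqrt_eq_rpow]
      ring
    rw [e, div_mul_div_comm, mul_self_sqrt (by norm_num), div_mul_div_comm,
      mul_self_sqrt pi_pos.le]
    linarith [pi_gt_three]
  have lift {k l : ℕ} (h : G (k + l) ≤ G k * G l) : G (k + 2 + l) ≤ G (k + 2) * G l := by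
    rw [add_right_comm, hstep, hstep, mul_right_comm]
    exact mul_le_mul h (hR' (Nat.le_add_right k l)) (hR _) (mul_pos (hG _) (hG _)).le
  have h₁ (l : ℕ) : G (1 + l) ≤ G 1 * G l := by
    induction l using Nat.twoStepInduction with
    | zero => simp [hG0]
    | one => simpa [hG2] using hG1
    | more l ih _ =>
      rw [add_comm, mul_comm] at ih ⊢
      exact lift ih
  change G (m + n) ≤ G m * G n
  induction m using Nat.twoStepInduction with
  | zero => simp [hG0]
  | one => exact h₁ n
  | more m ih _ => exact lift ih

theorem Gamma_div_mul_Gamma_le {m n : ℕ} (hm : 0 < m) (hn : 0 < n) :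
    Real.Gamma (m / 2 + n / 2) / (Real.Gamma (n / 2) * Real.Gamma (m / 2)) / (n / 2 : ℝ) ≤
      ((m / 2 + n / 2) / (m / 2) : ℝ) ^ (m / 2 - 1 : ℝ) *
        ((m / 2 + n / 2) / (n / 2) : ℝ) ^ (n / 2 : ℝ) := by
  have h := Gamma_add_one_div_rpow_half_add_le m n
  have e : ((m + n : ℕ) / 2 : ℝ) = m / 2 + n / 2 := by push_cast; ring
  rw [e] at h
  have hx : 0 < (m / 2 : ℝ) := by positivity
  have hy : 0 < (n / 2 : ℝ) := by positivity
  generalize (m / 2 : ℝ) = x at *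
  generalize (n / 2 : ℝ) = y at *
  have hxy := add_pos hx hy
  rw [Real.Gamma_add_one hx.ne', Real.Gamma_add_one hy.ne', Real.Gamma_add_one hxy.ne'] at h
  have := Real.Gamma_pos_of_pos hx
  have := Real.Gamma_pos_of_pos hy
  rw [div_rpow hxy.le hx.le, div_rpow hxy.le hy.le, rpow_sub_one hxy.ne', rpow_sub_one hx.ne']
  rw [rpow_add hxy] at h
  rw [div_mul_div_comm, div_le_div_iff₀ (by positivity) (by positivity)] at h
  rw [div_div, div_div_div_eq, div_mul_div_comm, div_le_div_iff₀ (by positivity) (by positivity)]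
  refine (le_of_eq ?_).trans (h.trans (le_of_eq ?_)) <;> ring

theorem stmt18 {L : ℕ} (hL : 2 ≤ L)
    (ν : Measure (Sph L)) (hν : IsUniformSphere ν)
    (La Lb Lc : ℕ) (hLa : 1 ≤ La) (hLb : 1 ≤ Lb) (hLc : 1 ≤ Lc)
    (hsum : La + Lb + Lc = L + 1)
    (δ : ℝ) (hδ : δ ∈ Set.Icc (0:ℝ) 1) :
    (ν {v : Sph L | ncSq (La+Lb) (v : EuclideanSpace ℝ (Fin (L+1))) < δ}).toReal
      = (Real.Gamma (((L:ℝ)+1)/2) / (Real.Gamma ((Lc:ℝ)/2) * Real.Gamma (((La:ℝ)+(Lb:ℝ))/2)))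
          * ∫ x in (0:ℝ)..δ, x ^ ((Lc:ℝ)/2 - 1) * (1-x) ^ (((La:ℝ)+(Lb:ℝ))/2 - 1) ∧
    ((La, Lb) ≠ (1, 1) →
      (ν {v : Sph L | ncSq (La+Lb) (v : EuclideanSpace ℝ (Fin (L+1))) < δ}).toReal
        ≤ (((L:ℝ)+1)/((La:ℝ)+(Lb:ℝ))) ^ (((La:ℝ)+(Lb:ℝ))/2 - 1)
            * ((((L:ℝ)+1) * δ / (Lc:ℝ)) ^ ((Lc:ℝ)/2)) * (1 - δ/6)) := by
  have hpL : (((La + Lb : ℕ) : ℝ)) = La + Lb := by push_cast; ring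
  have hL' : (L : ℝ) + 1 = La + Lb + Lc := by exact_mod_cast hsum.symm
  have hlaw := hν.ncSq_lt (m := La + Lb) (by omega) (by omega) δ
  rw [show L + 1 - (La + Lb) = Lc by omega, hpL] at hlaw
  have hLc' : (1 : ℝ) ≤ Lc := by exact_mod_cast hLc
  have hLab : (0 : ℝ) < La + Lb := by positivity
  have hmain := betaMeasure_Iio_toReal (q := (Lc : ℝ) / 2) (p := ((La : ℝ) + Lb) / 2)
    (by positivity) (by positivity) hδ
  rw [← hlaw, ← add_div, add_comm (Lc : ℝ), ← hL'] at hmain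
  refine ⟨hmain, fun hne => ?_⟩
  have h3 : 3 ≤ La + Lb := by
    by_contra h
    exact hne (by ext <;> simp <;> omega)
  have h3' : (3 : ℝ) ≤ La + Lb := by exact_mod_cast h3
  have hint := integral_rpow_mul_one_sub_rpow_le (q := (Lc : ℝ) / 2) (p := ((La : ℝ) + Lb) / 2)
    (by linarith) (by linarith) hδ
  have hΓ := Gamma_div_mul_Gamma_le (m := La + Lb) (n := Lc) (by omega) (by omega)
  rw [hpL, ← add_div, ← hL', div_div_div_cancel_right₀ two_ne_zero,
    div_div_div_cancel_right₀ two_ne_zero] at hΓ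
  have hδ₀ := hδ.1
  have hδ₁ := hδ.2
  have hc : 0 ≤ Real.Gamma (((L : ℝ) + 1) / 2) /
      (Real.Gamma ((Lc : ℝ) / 2) * Real.Gamma (((La : ℝ) + Lb) / 2)) := by
    have := Real.Gamma_pos_of_pos (s := ((L : ℝ) + 1) / 2) (by positivity)
    have := Real.Gamma_pos_of_pos (s := (Lc : ℝ) / 2) (by positivity)
    have := Real.Gamma_pos_of_pos (s := ((La : ℝ) + Lb) / 2) (by positivity)
    positivity
  rw [hmain, mul_div_right_comm _ δ, mul_rpow (by positivity) hδ₀]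
  have hδ₂ : 0 ≤ δ ^ ((Lc : ℝ) / 2) * (1 - δ / 6) :=
    mul_nonneg (by positivity) (by linarith)
  calc _ ≤ _ := mul_le_mul_of_nonneg_left hint hc
    _ = _ / ((Lc : ℝ) / 2) * (δ ^ ((Lc : ℝ) / 2) * (1 - δ / 6)) := by ring
    _ ≤ _ := mul_le_mul_of_nonneg_right hΓ hδ₂
    _ = _ := by ring
end
end
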